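/- arXiv:2205.14431 — 2 statements merged into one kernel-verified Lean document; each statement's English description precedes it below -/
import Mathlib

section
/- Let N > 1 be an integer, α > 0, b ≤ 0 < k with (−b)^{1/α}·√(1+k²) < k·N, and fix initial data u₀ ∈ C²([0,1]) with u₀'(0) = 0, u₀'(1) = k, whose initial mean curvature satisfies H(r,0) > 0 and H(r,0)^α + b > 0 for all r ∈ [0,1]. Then there exist positive constants M₀, M₁, M₂, V_*, V^*, H_*, H^*, depending only on N, α, b, k and u₀ (and not on T), such that for every T ∈ (0, ∞] and every classical solution u of the flow on [0,T) with initial data u₀ and with H(r,t) > 0 throughout, one has for all t ∈ [0,T): |u(r,t) − c̃(b,k)·t| ≤ M₀ for r ∈ [0,1]; 0 < u_r(r,t) ≤ M₁ for r ∈ (0,1]; V_* ≤ u_t(r,t) ≤ V^* for r ∈ [0,1]; H_* ≤ H(r,t) ≤ H^* for r ∈ (0,1]; and |u_rr(r,t)| ≤ M₂ for r ∈ [0,1]. -/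
open Set Filter Topology

/-- Signed power: the usual real power for nonnegative arguments, extended oddly
to negative arguments (matching `x^{e}` for `1/e = p/q` with `p, q` odd). -/
noncomputable def oddPow (x e : ℝ) : ℝ := if 0 ≤ x then x ^ e else -((-x) ^ e)

/-- `φ`, with first derivative `φ'` and second derivative `φ''`, solves the
translating-profile equation
`φ''/(1+φ'²) + ((N−1)/r)·φ' = (c/√(1+φ'²) − b)^{1/α}·√(1+φ'²)` for `r ∈ J`, `r ≠ 0`,
with the initial conditions `φ(0) = φ'(0) = 0`. -/
def IsProfileSolOn (N : ℕ) (α b c : ℝ) (J : Set ℝ) (φ φ' φ'' : ℝ → ℝ) : Prop :=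
  φ 0 = 0 ∧ φ' 0 = 0 ∧
  (∀ r ∈ J, HasDerivWithinAt φ (φ' r) J r) ∧
  (∀ r ∈ J, HasDerivWithinAt φ' (φ'' r) J r) ∧
  (∀ r ∈ J, r ≠ 0 →
    φ'' r / (1 + φ' r ^ 2) + (((N : ℝ) - 1) / r) * φ' r
      = oddPow (c / Real.sqrt (1 + φ' r ^ 2) - b) (1 / α) * Real.sqrt (1 + φ' r ^ 2))

/-- `φ` is the unique solution of the translating-profile problem, defined on its
maximal existence interval `[0, R)`: it is a solution there, and any solution on any
interval `[0, S)` satisfies `S ≤ R` and coincides with `φ` on `[0, S)`. -/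
def IsMaxProfileSol (N : ℕ) (α b c R : ℝ) (φ φ' φ'' : ℝ → ℝ) : Prop :=
  0 < R ∧ IsProfileSolOn N α b c (Set.Ico 0 R) φ φ' φ'' ∧
  ∀ S ψ ψ' ψ'', 0 < S → IsProfileSolOn N α b c (Set.Ico 0 S) ψ ψ' ψ'' →
    S ≤ R ∧ Set.EqOn ψ φ (Set.Ico 0 S)

open scoped ENNReal

/-- The mean curvature of the radially symmetric graph with slope `ur` and second
derivative `urr` at radius `r`; at `r = 0` it equals `N·u_rr(0)`. -/
noncomputable def meanCurv (N : ℕ) (r ur urr : ℝ) : ℝ :=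
  if r = 0 then (N : ℝ) * urr
  else urr / (1 + ur ^ 2) ^ ((3 : ℝ) / 2)
    + ((N : ℝ) - 1) * ur / (r * Real.sqrt (1 + ur ^ 2))

/-- `u₀` is `C²` initial data on `[0,1]`, with derivative `u₀'`, second derivative
`u₀''`, and boundary slopes `u₀'(0) = 0`, `u₀'(1) = k`. -/
def IsC2Data (k : ℝ) (u₀ u₀' u₀'' : ℝ → ℝ) : Prop :=
  (∀ r ∈ Set.Icc (0:ℝ) 1, HasDerivWithinAt u₀ (u₀' r) (Set.Icc 0 1) r) ∧
  (∀ r ∈ Set.Icc (0:ℝ) 1, HasDerivWithinAt u₀' (u₀'' r) (Set.Icc 0 1) r) ∧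
  ContinuousOn u₀'' (Set.Icc (0:ℝ) 1) ∧ u₀' 0 = 0 ∧ u₀' 1 = k

/-- `u` (with spatial derivatives `ur`, `urr` and time derivative `ut`) is a classical
solution of the flow `u_t = (H^α + b)·√(1+u_r²)` on `[0,1] × I`, with initial data
`u₀` (whose derivatives are `u₀'`, `u₀''`) and boundary slopes `u_r(0,t) = 0`,
`u_r(1,t) = k`. -/
def IsFlowSol (N : ℕ) (α b k : ℝ) (u₀ u₀' u₀'' : ℝ → ℝ) (I : Set ℝ)
    (u ur urr ut : ℝ → ℝ → ℝ) : Prop :=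
  ContinuousOn (fun p : ℝ × ℝ => u p.1 p.2) (Set.Icc 0 1 ×ˢ I) ∧
  ContinuousOn (fun p : ℝ × ℝ => ur p.1 p.2) (Set.Icc 0 1 ×ˢ I) ∧
  ContinuousOn (fun p : ℝ × ℝ => urr p.1 p.2) (Set.Icc 0 1 ×ˢ I) ∧
  ContinuousOn (fun p : ℝ × ℝ => ut p.1 p.2) (Set.Icc 0 1 ×ˢ I) ∧
  (∀ t ∈ I, ∀ r ∈ Set.Icc (0:ℝ) 1,
    HasDerivWithinAt (fun s => u s t) (ur r t) (Set.Icc 0 1) r) ∧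
  (∀ t ∈ I, ∀ r ∈ Set.Icc (0:ℝ) 1,
    HasDerivWithinAt (fun s => ur s t) (urr r t) (Set.Icc 0 1) r) ∧
  (∀ r ∈ Set.Icc (0:ℝ) 1, ∀ t ∈ I, HasDerivWithinAt (fun s => u r s) (ut r t) I t) ∧
  (∀ r ∈ Set.Icc (0:ℝ) 1, u r 0 = u₀ r ∧ ur r 0 = u₀' r ∧ urr r 0 = u₀'' r) ∧
  (∀ t ∈ I, ur 0 t = 0 ∧ ur 1 t = k) ∧
  (∀ t ∈ I, ∀ r ∈ Set.Ioc (0:ℝ) 1,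
    ut r t = (oddPow (meanCurv N r (ur r t) (urr r t)) α + b) * Real.sqrt (1 + ur r t ^ 2))

/-- The time interval `[0, T)` for `T ∈ (0, ∞]`, as a set of real numbers. -/
def timeSet (T : ℝ≥0∞) : Set ℝ := {t : ℝ | 0 ≤ t ∧ ENNReal.ofReal t < T}

/-- The speed as a function of radius, slope and second derivative. -/
noncomputable def speedF (N : ℕ) (α b r p q : ℝ) : ℝ :=
  (oddPow (meanCurv N r p q) α + b) * Real.sqrt (1 + p ^ 2)

lemma oddPow_pos' {x : ℝ} (hx : 0 ≤ x) (e : ℝ) : oddPow x e = x ^ e := by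
  simp [oddPow, hx]

lemma oddPow_mono {α : ℝ} (hα : 0 < α) : Monotone (fun x => oddPow x α) := by
  intro x y hxy
  simp only [oddPow]
  split_ifs with h1 h2 h2
  · exact Real.rpow_le_rpow h1 hxy hα.le
  · linarith
  · have h3 : 0 ≤ (-x) ^ α := Real.rpow_nonneg (by linarith) _
    have h4 : 0 ≤ y ^ α := Real.rpow_nonneg h2 _
    linarith
  · have : (-y) ^ α ≤ (-x) ^ α := Real.rpow_le_rpow (by linarith) (by linarith) hα.le
    linarith

lemma rpow_three_half (p : ℝ) :
    (1 + p ^ 2) ^ ((3 : ℝ) / 2) = (1 + p ^ 2) * Real.sqrt (1 + p ^ 2) := by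
  have h : (0 : ℝ) < 1 + p ^ 2 := by positivity
  rw [show (3 : ℝ) / 2 = 1 + 1 / 2 by norm_num, Real.rpow_add h, Real.rpow_one,
    Real.sqrt_eq_rpow]

lemma meanCurv_mono (N : ℕ) (r p : ℝ) : Monotone (fun q => meanCurv N r p q) := by
  intro q q' h
  simp only [meanCurv]
  split_ifs with h0
  · exact mul_le_mul_of_nonneg_left h (Nat.cast_nonneg N)
  · have : (0 : ℝ) < (1 + p ^ 2) ^ ((3 : ℝ) / 2) := by positivity
    gcongr

lemma speedF_mono (N : ℕ) {α : ℝ} (hα : 0 < α) (b r p : ℝ) :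
    Monotone (fun q => speedF N α b r p q) := by
  intro q q' h
  simp only [speedF]
  have := oddPow_mono hα (meanCurv_mono N r p h)
  simp only at this
  have h2 := Real.sqrt_nonneg (1 + p ^ 2)
  gcongr

/-- second derivative test at a maximum, up to the boundary -/
lemma second_deriv_nonpos {f f' : ℝ → ℝ} {f2 r0 : ℝ} (hr0 : r0 ∈ Icc (0 : ℝ) 1)
    (hf : ∀ r ∈ Icc (0 : ℝ) 1, HasDerivWithinAt f (f' r) (Icc 0 1) r)
    (hf' : HasDerivWithinAt f' f2 (Icc 0 1) r0) (h0 : f' r0 = 0)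
    (hmax : ∀ r ∈ Icc (0 : ℝ) 1, f r ≤ f r0) : f2 ≤ 0 := by
  by_contra hcon
  push Not at hcon
  have hs := hasDerivWithinAt_iff_tendsto_slope.1 hf'
  have hev : ∀ᶠ y in 𝓝[Icc 0 1 \ {r0}] r0, 0 < slope f' r0 y := hs.eventually (lt_mem_nhds hcon)
  rw [eventually_nhdsWithin_iff, Metric.eventually_nhds_iff] at hev
  obtain ⟨δ, hδ, hev⟩ := hev
  have hcont : ContinuousOn f (Icc 0 1) := fun r hr => (hf r hr).continuousWithinAt
  rcases lt_or_eq_of_le hr0.2 with hlt | heq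
  · set r1 := min 1 (r0 + δ / 2) with hr1
    have h1 : r0 < r1 := lt_min hlt (by linarith)
    have h11 : r1 ≤ 1 := min_le_left _ _
    have h12 : r1 ≤ r0 + δ / 2 := min_le_right _ _
    have hsub : Icc r0 r1 ⊆ Icc 0 1 := Icc_subset_Icc hr0.1 h11
    have hmono : StrictMonoOn f (Icc r0 r1) := by
      apply strictMonoOn_of_hasDerivWithinAt_pos (f' := f') (convex_Icc _ _) (hcont.mono hsub)
      · intro x hx
        rw [interior_Icc] at hx ⊢
        exact (hf x (hsub ⟨hx.1.le, hx.2.le⟩)).mono (Ioo_subset_Icc_self.trans hsub)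
      · intro x hx
        rw [interior_Icc] at hx
        have := hev (y := x) (by rw [Real.dist_eq, abs_of_pos (by linarith [hx.1])]; linarith [hx.2])
          ⟨hsub ⟨hx.1.le, hx.2.le⟩, by simpa using hx.1.ne'⟩
        rw [slope_def_field, h0, sub_zero] at this
        rcases div_pos_iff.1 this with h | h
        · exact h.1
        · linarith [h.2, hx.1]
    have := hmono ⟨le_rfl, h1.le⟩ ⟨h1.le, le_rfl⟩ h1
    linarith [hmax r1 ⟨hr0.1.trans h1.le, h11⟩]
  · set r1 := max 0 (r0 - δ / 2) with hr1
    have h1 : r1 < r0 := max_lt (by linarith) (by linarith)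
    have h11 : 0 ≤ r1 := le_max_left _ _
    have h12 : r0 - δ / 2 ≤ r1 := le_max_right _ _
    have hsub : Icc r1 r0 ⊆ Icc 0 1 := Icc_subset_Icc h11 hr0.2
    have hmono : StrictAntiOn f (Icc r1 r0) := by
      apply strictAntiOn_of_hasDerivWithinAt_neg (f' := f') (convex_Icc _ _) (hcont.mono hsub)
      · intro x hx
        rw [interior_Icc] at hx ⊢
        exact (hf x (hsub ⟨hx.1.le, hx.2.le⟩)).mono (Ioo_subset_Icc_self.trans hsub)
      · intro x hx
        rw [interior_Icc] at hx
        have := hev (y := x) (by rw [Real.dist_eq, abs_of_neg (by linarith [hx.2])]; linarith [hx.1])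
          ⟨hsub ⟨hx.1.le, hx.2.le⟩, by simpa using hx.2.ne⟩
        rw [slope_def_field, h0, sub_zero] at this
        rcases div_pos_iff.1 this with h | h
        · linarith [h.2, hx.2]
        · exact h.1
    have := hmono ⟨le_rfl, h1.le⟩ ⟨h1.le, le_rfl⟩ h1
    linarith [hmax r1 ⟨h11, h1.le.trans hr0.2⟩]

/-- one-sided time derivative at a maximum -/
lemma left_deriv_nonneg {g : ℝ → ℝ} {g' t0 τ : ℝ} (ht0 : 0 < t0) (ht : t0 ≤ τ)
    (hg : HasDerivWithinAt g g' (Icc 0 τ) t0) (hmax : ∀ s ∈ Icc 0 τ, g s ≤ g t0) : 0 ≤ g' := by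
  have h1 : HasDerivWithinAt g g' (Ioo 0 t0) t0 :=
    hg.mono (fun x hx => ⟨hx.1.le, hx.2.le.trans ht⟩)
  have hs := hasDerivWithinAt_iff_tendsto_slope' (by simp) |>.1 h1
  have : (𝓝[Ioo 0 t0] t0).NeBot := by
    rw [← mem_closure_iff_nhdsWithin_neBot, closure_Ioo ht0.ne]
    exact ⟨ht0.le, le_rfl⟩
  refine ge_of_tendsto hs ?_
  filter_upwards [self_mem_nhdsWithin] with x hx
  rw [slope_def_field]
  exact div_nonneg_of_nonpos (by linarith [hmax x ⟨hx.1.le, hx.2.le.trans ht⟩]) (by linarith [hx.2])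

/-- `u` with derivatives solves the equation on `[0,1] × [0,τ]` including at `r = 0`. -/
structure SolOn (N : ℕ) (α b k τ : ℝ) (u ur urr ut : ℝ → ℝ → ℝ) : Prop where
  cont : ContinuousOn (fun p : ℝ × ℝ => u p.1 p.2) (Set.Icc 0 1 ×ˢ Set.Icc 0 τ)
  dr : ∀ t ∈ Icc 0 τ, ∀ r ∈ Icc (0:ℝ) 1, HasDerivWithinAt (fun s => u s t) (ur r t) (Icc 0 1) r
  drr : ∀ t ∈ Icc 0 τ, ∀ r ∈ Icc (0:ℝ) 1, HasDerivWithinAt (fun s => ur s t) (urr r t) (Icc 0 1) r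
  dt : ∀ r ∈ Icc (0:ℝ) 1, ∀ t ∈ Icc 0 τ, HasDerivWithinAt (fun s => u r s) (ut r t) (Icc 0 τ) t
  bdy : ∀ t ∈ Icc 0 τ, ur 0 t = 0 ∧ ur 1 t = k
  eqn : ∀ t ∈ Icc 0 τ, ∀ r ∈ Icc (0:ℝ) 1, ut r t = speedF N α b r (ur r t) (urr r t)

lemma comparison {N : ℕ} {α b k τ : ℝ} (hα : 0 < α) {u ur urr ut v vr vrr vt : ℝ → ℝ → ℝ}
    (hu : SolOn N α b k τ u ur urr ut) (hv : SolOn N α b k τ v vr vrr vt) (hτ : 0 ≤ τ) {C : ℝ}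
    (h0 : ∀ r ∈ Icc (0:ℝ) 1, u r 0 - v r 0 ≤ C) :
    ∀ t ∈ Icc 0 τ, ∀ r ∈ Icc (0:ℝ) 1, u r t - v r t ≤ C := by
  intro t ht r hr
  have key : ∀ ε > 0, u r t - v r t - ε * t ≤ C := by
    intro ε hε
    have hc : ContinuousOn (fun p : ℝ × ℝ => u p.1 p.2 - v p.1 p.2 - ε * p.2)
        (Set.Icc 0 1 ×ˢ Set.Icc 0 τ) := by
      exact (hu.cont.sub hv.cont).sub (by fun_prop)
    obtain ⟨⟨r0, t0⟩, ⟨hr0, ht0⟩, hmax⟩ := (isCompact_Icc.prod isCompact_Icc).exists_isMaxOn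
      ⟨((0 : ℝ), (0 : ℝ)), by simp [hτ]⟩ hc
    simp only at hr0 ht0
    have hmax' : ∀ r ∈ Icc (0:ℝ) 1, ∀ t ∈ Icc 0 τ,
        u r t - v r t - ε * t ≤ u r0 t0 - v r0 t0 - ε * t0 := fun r hr t ht =>
      hmax (show (r, t) ∈ Set.Icc (0:ℝ) 1 ×ˢ Set.Icc 0 τ from ⟨hr, ht⟩)
    refine (hmax' r hr t ht).trans ?_
    rcases eq_or_lt_of_le ht0.1 with h | hpos
    · rw [← h]; simpa using h0 r0 hr0
    · exfalso
      have hd : ∀ r ∈ Icc (0:ℝ) 1, HasDerivWithinAt (fun s => u s t0 - v s t0)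
          (ur r t0 - vr r t0) (Icc 0 1) r := fun r hr => (hu.dr t0 ht0 r hr).sub (hv.dr t0 ht0 r hr)
      have hsm : ∀ r ∈ Icc (0:ℝ) 1, u r t0 - v r t0 ≤ u r0 t0 - v r0 t0 := fun r hr => by
        linarith [hmax' r hr t0 ht0]
      have hz : ur r0 t0 - vr r0 t0 = 0 := by
        rcases eq_or_lt_of_le hr0.1 with h | hp
        · rw [← h, (hu.bdy t0 ht0).1, (hv.bdy t0 ht0).1, sub_zero]
        rcases eq_or_lt_of_le hr0.2 with h | hp1
        · rw [h, (hu.bdy t0 ht0).2, (hv.bdy t0 ht0).2, sub_self]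
        have hn : Icc (0:ℝ) 1 ∈ 𝓝 r0 := Icc_mem_nhds hp hp1
        refine IsLocalMax.hasDerivAt_eq_zero ?_ ((hd r0 hr0).hasDerivAt hn)
        filter_upwards [hn] with x hx using hsm x hx
      have h2 := second_deriv_nonpos (f' := fun r => ur r t0 - vr r t0) hr0 hd
        ((hu.drr t0 ht0 r0 hr0).sub (hv.drr t0 ht0 r0 hr0)) hz hsm
      have h3 : 0 ≤ ut r0 t0 - vt r0 t0 - ε * 1 := by
        refine left_deriv_nonneg hpos ht0.2 (g := fun s => u r0 s - v r0 s - ε * s) ?_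
          (fun s hs => hmax' r0 hr0 s hs)
        exact ((hu.dt r0 hr0 t0 ht0).sub (hv.dt r0 hr0 t0 ht0)).sub
          ((hasDerivWithinAt_id _ _).const_mul ε)
      have h4 : ut r0 t0 ≤ vt r0 t0 := by
        rw [hu.eqn t0 ht0 r0 hr0, hv.eqn t0 ht0 r0 hr0, sub_eq_zero.1 hz]
        exact speedF_mono N hα b r0 _ (by linarith)
      linarith
  have hlim : Tendsto (fun ε : ℝ => u r t - v r t - ε * t) (𝓝[>] 0) (𝓝 (u r t - v r t - 0 * t)) := by
    apply Tendsto.mono_left _ nhdsWithin_le_nhds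
    exact Continuous.tendsto (by fun_prop) 0
  rw [zero_mul, sub_zero] at hlim
  exact le_of_tendsto hlim (by filter_upwards [self_mem_nhdsWithin] with ε hε using key ε hε)

lemma meanCurv_cont (N : ℕ) {p q : ℝ → ℝ} (h0 : p 0 = 0)
    (hp : ∀ r ∈ Icc (0 : ℝ) 1, HasDerivWithinAt p (q r) (Icc 0 1) r)
    (hq : ContinuousOn q (Icc 0 1)) :
    ContinuousOn (fun r => meanCurv N r (p r) (q r)) (Icc 0 1) := by
  have hpc : ContinuousOn p (Icc 0 1) := fun r hr => (hp r hr).continuousWithinAt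
  intro r hr
  have hA : ∀ x : ℝ, (0:ℝ) < (1 + x ^ 2) ^ ((3 : ℝ) / 2) := fun x => by positivity
  have hB : ∀ x : ℝ, (0:ℝ) < Real.sqrt (1 + x ^ 2) := fun x => by positivity
  have hAc : ContinuousWithinAt (fun r => (1 + p r ^ 2) ^ ((3 : ℝ) / 2)) (Icc 0 1) r := by
    have : ContinuousWithinAt (fun r => 1 + p r ^ 2) (Icc 0 1) r :=
      continuousWithinAt_const.add ((hpc r hr).pow 2)
    exact this.rpow_const (Or.inr (by norm_num))
  have hBc : ContinuousWithinAt (fun r => Real.sqrt (1 + p r ^ 2)) (Icc 0 1) r :=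
    (continuousWithinAt_const.add ((hpc r hr).pow 2)).sqrt
  rcases eq_or_lt_of_le hr.1 with h | hpos
  · subst h
    rw [← continuousWithinAt_sdiff_self]
    have hs := hasDerivWithinAt_iff_tendsto_slope.1 (hp 0 hr)
    have hle : 𝓝[Icc (0:ℝ) 1 \ {0}] 0 ≤ 𝓝[Icc (0:ℝ) 1] 0 := nhdsWithin_mono _ sdiff_subset
    have h1 := ((hq 0 hr).tendsto.mono_left hle).div (hAc.tendsto.mono_left hle) (hA _).ne'
    have h2 := (hs.const_mul ((N : ℝ) - 1)).div (hBc.tendsto.mono_left hle) (hB _).ne'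
    have h3 := h1.add h2
    have h4 : q 0 / (1 + p 0 ^ 2) ^ ((3 : ℝ) / 2) + ((N : ℝ) - 1) * q 0 / Real.sqrt (1 + p 0 ^ 2)
        = meanCurv N 0 (p 0) (q 0) := by
      simp [meanCurv, h0]; ring
    rw [h4] at h3
    refine Tendsto.congr' ?_ h3
    filter_upwards [self_mem_nhdsWithin] with x hx
    have hx0 : x ≠ 0 := hx.2
    simp only [meanCurv, if_neg hx0, slope_def_field, h0, sub_zero, Pi.div_apply]
    have := (hB (p x)).ne'
    field_simp
  · have hc : ContinuousWithinAt (fun r => q r / (1 + p r ^ 2) ^ ((3 : ℝ) / 2)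
        + ((N : ℝ) - 1) * p r / (r * Real.sqrt (1 + p r ^ 2))) (Icc 0 1) r := by
      refine ((hq r hr).div hAc (hA _).ne').add (ContinuousWithinAt.div ?_ ?_ ?_)
      · exact continuousWithinAt_const.mul (hpc r hr)
      · exact continuousWithinAt_id.mul hBc
      · exact mul_ne_zero hpos.ne' (hB _).ne'
    refine hc.congr_of_eventuallyEq ?_ (by simp [meanCurv, hpos.ne'])
    filter_upwards [mem_nhdsWithin_of_mem_nhds (lt_mem_nhds hpos)] with x hx
    simp [meanCurv, hx.ne']

lemma slope_deriv {p : ℝ → ℝ} {q r : ℝ} (hp : HasDerivAt p q r) :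
    HasDerivAt (fun x => p x / Real.sqrt (1 + p x ^ 2)) (q / (1 + p r ^ 2) ^ ((3 : ℝ) / 2)) r := by
  have h0 : (0:ℝ) < 1 + p r ^ 2 := by positivity
  have h1 : HasDerivAt (fun x => 1 + p x ^ 2) (2 * p r * q) r := by
    have := (hp.pow 2).const_add 1
    simpa using this
  have h2 := h1.sqrt h0.ne'
  have h3 := hp.div h2 (Real.sqrt_pos.2 h0).ne'
  refine h3.congr_deriv ?_
  rw [rpow_three_half]
  have hs := (Real.sqrt_pos.2 h0).ne'
  have hsq := Real.sq_sqrt h0.le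
  field_simp
  rw [hsq]; ring

/-- the flux function -/
noncomputable def flux (N : ℕ) (c : ℝ) (p : ℝ → ℝ) (x : ℝ) : ℝ :=
  x ^ (N - 1) * (p x / Real.sqrt (1 + p x ^ 2)) - c * x ^ N / N

lemma flux_deriv {N : ℕ} (hN : 1 < N) (c : ℝ) {p : ℝ → ℝ} {q r : ℝ} (hr : 0 < r)
    (hp : HasDerivAt p q r) :
    HasDerivAt (flux N c p) (r ^ (N - 1) * (meanCurv N r (p r) q - c)) r := by
  obtain ⟨m, rfl⟩ : ∃ m, N = m + 2 := ⟨N - 2, by omega⟩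
  have h1 := ((hasDerivAt_pow (m + 2 - 1) r).mul (slope_deriv hp)).sub
    (((hasDerivAt_pow (m + 2) r).const_mul c).div_const ((m + 2 : ℕ) : ℝ))
  refine h1.congr_deriv ?_
  simp only [meanCurv, if_neg hr.ne']
  have h0 : (0:ℝ) < 1 + p r ^ 2 := by positivity
  have hs := (Real.sqrt_pos.2 h0).ne'
  have hA : (0:ℝ) < (1 + p r ^ 2) ^ ((3 : ℝ) / 2) := by positivity
  have hn : ((m : ℝ) + 2) ≠ 0 := by positivity
  simp only [show m + 2 - 1 = m + 1 by omega, show m + 1 - 1 = m by omega]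
  push_cast
  field_simp
  ring

lemma flux_cont (N : ℕ) (c : ℝ) {p q : ℝ → ℝ}
    (hp : ∀ r ∈ Icc (0 : ℝ) 1, HasDerivWithinAt p (q r) (Icc 0 1) r) :
    ContinuousOn (flux N c p) (Icc 0 1) := by
  have hpc : ContinuousOn p (Icc 0 1) := fun r hr => (hp r hr).continuousWithinAt
  unfold flux
  refine ContinuousOn.sub (ContinuousOn.mul (by fun_prop) (hpc.div ?_ ?_)) (by fun_prop)
  · exact (continuousOn_const.add (hpc.pow 2)).sqrt
  · intro x _; positivity

lemma flux_mono {N : ℕ} (hN : 1 < N) (c : ℝ) {p q : ℝ → ℝ}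
    (hp : ∀ r ∈ Icc (0 : ℝ) 1, HasDerivWithinAt p (q r) (Icc 0 1) r)
    (hH : ∀ r ∈ Ioo (0 : ℝ) 1, c ≤ meanCurv N r (p r) (q r)) :
    MonotoneOn (flux N c p) (Icc 0 1) := by
  apply monotoneOn_of_hasDerivWithinAt_nonneg (convex_Icc _ _) (flux_cont N c hp)
    (f' := fun r => r ^ (N - 1) * (meanCurv N r (p r) (q r) - c))
  · intro x hx
    rw [interior_Icc] at hx
    exact (flux_deriv hN c hx.1 ((hp x ⟨hx.1.le, hx.2.le⟩).hasDerivAt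
      (Icc_mem_nhds hx.1 hx.2))).hasDerivWithinAt
  · intro x hx
    rw [interior_Icc] at hx
    exact mul_nonneg (pow_nonneg hx.1.le _) (by linarith [hH x hx])

lemma flux_anti {N : ℕ} (hN : 1 < N) (c : ℝ) {p q : ℝ → ℝ}
    (hp : ∀ r ∈ Icc (0 : ℝ) 1, HasDerivWithinAt p (q r) (Icc 0 1) r)
    (hH : ∀ r ∈ Ioo (0 : ℝ) 1, meanCurv N r (p r) (q r) ≤ c) :
    AntitoneOn (flux N c p) (Icc 0 1) := by
  apply antitoneOn_of_hasDerivWithinAt_nonpos (convex_Icc _ _) (flux_cont N c hp)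
    (f' := fun r => r ^ (N - 1) * (meanCurv N r (p r) (q r) - c))
  · intro x hx
    rw [interior_Icc] at hx
    exact (flux_deriv hN c hx.1 ((hp x ⟨hx.1.le, hx.2.le⟩).hasDerivAt
      (Icc_mem_nhds hx.1 hx.2))).hasDerivWithinAt
  · intro x hx
    rw [interior_Icc] at hx
    exact mul_nonpos_of_nonneg_of_nonpos (pow_nonneg hx.1.le _) (by linarith [hH x hx])

lemma flux_strict {N : ℕ} (hN : 1 < N) {p q : ℝ → ℝ}
    (hp : ∀ r ∈ Icc (0 : ℝ) 1, HasDerivWithinAt p (q r) (Icc 0 1) r)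
    (hH : ∀ r ∈ Ioo (0 : ℝ) 1, 0 < meanCurv N r (p r) (q r)) :
    StrictMonoOn (flux N 0 p) (Icc 0 1) := by
  apply strictMonoOn_of_hasDerivWithinAt_pos (convex_Icc _ _) (flux_cont N 0 hp)
    (f' := fun r => r ^ (N - 1) * (meanCurv N r (p r) (q r) - 0))
  · intro x hx
    rw [interior_Icc] at hx
    exact (flux_deriv hN 0 hx.1 ((hp x ⟨hx.1.le, hx.2.le⟩).hasDerivAt
      (Icc_mem_nhds hx.1 hx.2))).hasDerivWithinAt
  · intro x hx
    rw [interior_Icc] at hx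
    exact mul_pos (pow_pos hx.1 _) (by linarith [hH x hx])

lemma flux_zero {N : ℕ} (hN : 1 < N) (c : ℝ) (p : ℝ → ℝ) : flux N c p 0 = 0 := by
  have h1 : N - 1 ≠ 0 := by omega
  have h2 : N ≠ 0 := by omega
  simp [flux, h1, h2]

lemma slope_pos {N : ℕ} (hN : 1 < N) {p q : ℝ → ℝ}
    (hp : ∀ r ∈ Icc (0 : ℝ) 1, HasDerivWithinAt p (q r) (Icc 0 1) r)
    (hH : ∀ r ∈ Ioo (0 : ℝ) 1, 0 < meanCurv N r (p r) (q r)) :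
    ∀ r ∈ Ioc (0 : ℝ) 1, 0 < p r := by
  intro r hr
  have h := flux_strict hN hp hH (left_mem_Icc.2 zero_le_one) ⟨hr.1.le, hr.2⟩ hr.1
  rw [flux_zero hN] at h
  simp only [flux, zero_mul, zero_div, sub_zero] at h
  have h1 := (mul_pos_iff_of_pos_left (pow_pos hr.1 _)).1 h
  have h0 : (0:ℝ) < Real.sqrt (1 + p r ^ 2) := by positivity
  exact (div_pos_iff_of_pos_right h0).1 h1

lemma exists_c0 (N : ℕ) {α b k V : ℝ} (hα : 0 < α) :
    ∃ c0 > 0, ∀ c, 0 < c → c < c0 →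
      k / Real.sqrt (1 + k ^ 2) <
        Real.sqrt (1 - c ^ 2) - ((V * c - b) ^ (1 / α) - (-b) ^ (1 / α)) / N := by
  have hk : k / Real.sqrt (1 + k ^ 2) < 1 := by
    rw [div_lt_one (by positivity)]
    refine (le_abs_self k).trans_lt ?_
    apply Real.lt_sqrt_of_sq_lt
    rw [sq_abs]; linarith
  have hc : ContinuousAt (fun c : ℝ =>
      Real.sqrt (1 - c ^ 2) - ((V * c - b) ^ (1 / α) - (-b) ^ (1 / α)) / N) 0 := by
    refine ContinuousAt.sub (by fun_prop) (ContinuousAt.div_const (ContinuousAt.sub ?_ continuousAt_const) _)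
    have : ContinuousAt (fun c : ℝ => V * c - b) 0 := by fun_prop
    exact this.rpow_const (Or.inr (by positivity))
  have hev := hc.eventually (lt_mem_nhds (a := k / Real.sqrt (1 + k ^ 2)) (by simpa using hk))
  rw [Metric.eventually_nhds_iff] at hev
  obtain ⟨c0, h0, h⟩ := hev
  exact ⟨c0, h0, fun c h1 h2 => h (by rw [Real.dist_eq, sub_zero, abs_of_pos h1]; exact h2)⟩

lemma grad_bound {N : ℕ} (hN : 1 < N) {α b k V c0 : ℝ} (hk : 0 < k) (hc0 : 0 < c0)
    (hc : ∀ c, 0 < c → c < c0 →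
      k / Real.sqrt (1 + k ^ 2) <
        Real.sqrt (1 - c ^ 2) - ((V * c - b) ^ (1 / α) - (-b) ^ (1 / α)) / N)
    {p q : ℝ → ℝ} (hp0 : p 0 = 0) (hp1 : p 1 = k)
    (hp : ∀ r ∈ Icc (0 : ℝ) 1, HasDerivWithinAt p (q r) (Icc 0 1) r)
    (hlo : ∀ r ∈ Ioo (0 : ℝ) 1, (-b) ^ (1 / α) ≤ meanCurv N r (p r) (q r))
    (hhi : ∀ r ∈ Ioo (0 : ℝ) 1, meanCurv N r (p r) (q r) ≤
      (V * (1 / Real.sqrt (1 + p r ^ 2)) - b) ^ (1 / α)) :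
    ∀ r ∈ Icc (0 : ℝ) 1, p r ≤ max k (1 / c0) := by
  have hpc : ContinuousOn p (Icc 0 1) := fun r hr => (hp r hr).continuousWithinAt
  obtain ⟨x, hx, hmax⟩ := isCompact_Icc.exists_isMaxOn (nonempty_Icc.2 zero_le_one) hpc
  suffices h : p x ≤ max k (1 / c0) from fun r hr => (hmax hr).trans h
  by_contra hcon
  push Not at hcon
  have hxk : k < p x := (le_max_left _ _).trans_lt hcon
  have hxc : 1 / c0 < p x := (le_max_right _ _).trans_lt hcon
  have hx0 : 0 < x := by
    rcases eq_or_lt_of_le hx.1 with h | h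
    · rw [← h, hp0] at hxk; linarith
    · exact h
  have hx1 : x < 1 := by
    rcases eq_or_lt_of_le hx.2 with h | h
    · rw [h, hp1] at hxk; linarith
    · exact h
  have hn := Icc_mem_nhds hx0 hx1
  have hq : q x = 0 := by
    refine IsLocalMax.hasDerivAt_eq_zero ?_ ((hp x hx).hasDerivAt hn)
    filter_upwards [hn] with y hy using hmax hy
  have hD : (0:ℝ) < 1 + p x ^ 2 := by positivity
  have hS := Real.sqrt_pos.2 hD
  have hpx : 0 < p x := hk.trans hxk
  have hle : p x ≤ Real.sqrt (1 + p x ^ 2) := Real.le_sqrt_of_sq_le (by linarith)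
  have h1 := hc (1 / Real.sqrt (1 + p x ^ 2)) (by positivity) (by
    rw [div_lt_comm₀ hS hc0]; linarith)
  have hs : Real.sqrt (1 - (1 / Real.sqrt (1 + p x ^ 2)) ^ 2) = p x / Real.sqrt (1 + p x ^ 2) := by
    rw [Real.sqrt_eq_iff_mul_self_eq_of_pos (by positivity)]
    rw [div_pow, Real.sq_sqrt hD.le, div_mul_div_comm, Real.mul_self_sqrt hD.le]
    field_simp; ring
  rw [hs] at h1
  have h2 := hlo x ⟨hx0, hx1⟩
  have h3 := hhi x ⟨hx0, hx1⟩
  have h4 : meanCurv N x (p x) (q x) * x = ((N:ℝ) - 1) * (p x / Real.sqrt (1 + p x ^ 2)) := by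
    simp only [meanCurv, if_neg hx0.ne', hq]
    field_simp; ring
  have h5 := flux_mono hN ((-b) ^ (1 / α)) hp hlo hx (right_mem_Icc.2 zero_le_one) hx1.le
  simp only [flux, one_pow, hp1, one_mul, mul_one] at h5
  have hb := one_add_mul_le_pow (a := x - 1) (by linarith) N
  have hspos : 0 < p x / Real.sqrt (1 + p x ^ 2) := by positivity
  have hpow : x ^ N = x ^ (N - 1) * x := by
    rw [← pow_succ]; congr 1; omega
  have hNpos : (0:ℝ) < N := by positivity
  rw [add_sub_cancel] at hb
  have hy : 0 < x ^ (N - 1) := pow_pos hx0 _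
  rw [hpow] at hb h5
  generalize x ^ (N - 1) = y at *
  generalize p x / Real.sqrt (1 + p x ^ 2) = s at *
  generalize (-b) ^ (1 / α) = β at *
  generalize k / Real.sqrt (1 + k ^ 2) = κ at *
  generalize meanCurv N x (p x) (q x) = H at *
  generalize (V * (1 / Real.sqrt (1 + p x ^ 2)) - b) ^ (1 / α) = K at *
  have e1 : (N:ℝ) * κ < N * s - (K - β) := by
    have := mul_lt_mul_of_pos_left h1 hNpos
    rwa [mul_sub, mul_div_cancel₀ _ hNpos.ne'] at this
  have e2 : (N:ℝ) * (y * s) - β * (y * x) ≤ N * κ - β := by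
    have := mul_le_mul_of_nonneg_left h5 hNpos.le
    rwa [mul_sub, mul_sub, mul_div_cancel₀ _ hNpos.ne', mul_div_cancel₀ _ hNpos.ne'] at this
  have e3 : (N:ℝ) * (y * s) - β * (y * x) < N * s - H := by linarith
  have e4 : β * (y * x) ≤ H * (y * x) := mul_le_mul_of_nonneg_right h2 (by positivity)
  have e5 : H * (y * x) = y * (((N:ℝ) - 1) * s) := by rw [← h4]; ring
  have e6 : y * s < N * s - H := by nlinarith
  have e7 : y * s * x < (N * s - H) * x := mul_lt_mul_of_pos_right e6 hx0
  have e8 : s * (1 + N * (x - 1)) ≤ s * (y * x) := mul_le_mul_of_nonneg_left hb hspos.le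
  nlinarith

lemma SolOn.mono {N : ℕ} {α b k τ τ' : ℝ} {u ur urr ut : ℝ → ℝ → ℝ}
    (hu : SolOn N α b k τ u ur urr ut) (h : τ' ≤ τ) : SolOn N α b k τ' u ur urr ut := by
  have hs : Icc 0 τ' ⊆ Icc 0 τ := Icc_subset_Icc le_rfl h
  exact ⟨hu.cont.mono (prod_mono le_rfl hs), fun t ht => hu.dr t (hs ht), fun t ht => hu.drr t (hs ht),
    fun r hr t ht => (hu.dt r hr t (hs ht)).mono hs, fun t ht => hu.bdy t (hs ht),
    fun t ht => hu.eqn t (hs ht)⟩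

lemma SolOn.shift {N : ℕ} {α b k τ h : ℝ} {u ur urr ut : ℝ → ℝ → ℝ}
    (hu : SolOn N α b k (τ + h) u ur urr ut) (h0 : 0 ≤ h) :
    SolOn N α b k τ (fun r t => u r (t + h)) (fun r t => ur r (t + h))
      (fun r t => urr r (t + h)) (fun r t => ut r (t + h)) := by
  have hs : ∀ t ∈ Icc 0 τ, t + h ∈ Icc 0 (τ + h) := fun t ht => ⟨by linarith [ht.1], by linarith [ht.2]⟩
  refine ⟨?_, fun t ht => hu.dr _ (hs t ht), fun t ht => hu.drr _ (hs t ht), fun r hr t ht => ?_,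
    fun t ht => hu.bdy _ (hs t ht), fun t ht => hu.eqn _ (hs t ht)⟩
  · exact hu.cont.comp (f := fun p : ℝ × ℝ => (p.1, p.2 + h)) (by fun_prop)
      (fun p hp => ⟨hp.1, hs _ hp.2⟩)
  · have h1 := hu.dt r hr (t + h) (hs t ht)
    have h2 : HasDerivWithinAt (fun s : ℝ => s + h) 1 (Icc 0 τ) t :=
      (hasDerivWithinAt_id _ _).add_const h
    simpa [Function.comp_def] using h1.scomp t h2 hs

/-- uniform first-order expansion at time `0` -/
lemma unif_expand {τ : ℝ} (hτ : 0 < τ) {u ut : ℝ → ℝ → ℝ}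
    (hc : ContinuousOn (fun p : ℝ × ℝ => ut p.1 p.2) (Set.Icc 0 1 ×ˢ Set.Icc 0 τ))
    (hdt : ∀ r ∈ Icc (0:ℝ) 1, ∀ t ∈ Icc 0 τ,
      HasDerivWithinAt (fun s => u r s) (ut r t) (Icc 0 τ) t)
    {ε : ℝ} (hε : 0 < ε) : ∃ δ > 0, δ ≤ τ ∧ ∀ h ∈ Icc 0 δ, ∀ r ∈ Icc (0:ℝ) 1,
      u r h - u r 0 ≤ (ut r 0 + ε) * h ∧ (ut r 0 - ε) * h ≤ u r h - u r 0 := by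
  have huc := (isCompact_Icc.prod isCompact_Icc).uniformContinuousOn_of_continuous hc
  rw [Metric.uniformContinuousOn_iff] at huc
  obtain ⟨δ, hδ, huc⟩ := huc ε hε
  refine ⟨min τ (δ / 2), by positivity, min_le_left _ _, fun h hh r hr => ?_⟩
  have hτ' : h ≤ τ := hh.2.trans (min_le_left _ _)
  have hδ' : h ≤ δ / 2 := hh.2.trans (min_le_right _ _)
  have hsub : Icc 0 h ⊆ Icc 0 τ := Icc_subset_Icc le_rfl hτ'
  have hcl : ∀ s ∈ Icc 0 h, |ut r s - ut r 0| < ε := by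
    intro s hs
    have := huc (r, s) ⟨hr, hsub hs⟩ (r, 0) ⟨hr, ⟨le_rfl, hτ.le⟩⟩ (by
      rw [Prod.dist_eq]; simp only [dist_self, Real.dist_eq, sub_zero]
      rw [abs_of_nonneg hs.1]
      exact max_lt hδ (by linarith [hs.2]))
    simpa [Real.dist_eq] using this
  have hd : ∀ (c : ℝ), ∀ s ∈ Icc 0 h, HasDerivWithinAt (fun s => u r s - c * s) (ut r s - c) (Icc 0 h) s := by
    intro c s hs
    have := ((hdt r hr s (hsub hs)).mono hsub).sub ((hasDerivWithinAt_id s (Icc 0 h)).const_mul c)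
    rw [mul_one] at this
    exact this
  constructor
  · have : AntitoneOn (fun s => u r s - (ut r 0 + ε) * s) (Icc 0 h) := by
      apply antitoneOn_of_hasDerivWithinAt_nonpos (convex_Icc _ _)
        (fun s hs => (hd _ s hs).continuousWithinAt)
      · intro s hs; exact (hd _ s (interior_subset hs)).mono interior_subset
      · intro s hs
        have := abs_lt.1 (hcl s (interior_subset hs))
        linarith [this.2]
    have := this ⟨le_rfl, hh.1⟩ ⟨hh.1, le_rfl⟩ hh.1
    simp only [mul_zero, sub_zero] at this
    linarith
  · have : MonotoneOn (fun s => u r s - (ut r 0 - ε) * s) (Icc 0 h) := by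
      apply monotoneOn_of_hasDerivWithinAt_nonneg (convex_Icc _ _)
        (fun s hs => (hd _ s hs).continuousWithinAt)
      · intro s hs; exact (hd _ s (interior_subset hs)).mono interior_subset
      · intro s hs
        have := abs_lt.1 (hcl s (interior_subset hs))
        linarith [this.1]
    have := this ⟨le_rfl, hh.1⟩ ⟨hh.1, le_rfl⟩ hh.1
    simp only [mul_zero, sub_zero] at this
    linarith

lemma ut_bounds {N : ℕ} {α b k τ : ℝ} (hα : 0 < α) {u ur urr ut : ℝ → ℝ → ℝ}
    (hu : SolOn N α b k τ u ur urr ut)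
    (hc : ContinuousOn (fun p : ℝ × ℝ => ut p.1 p.2) (Set.Icc 0 1 ×ˢ Set.Icc 0 τ))
    {V W : ℝ} (h0 : ∀ r ∈ Icc (0:ℝ) 1, V ≤ ut r 0 ∧ ut r 0 ≤ W) :
    ∀ t ∈ Ico 0 τ, ∀ r ∈ Icc (0:ℝ) 1, V ≤ ut r t ∧ ut r t ≤ W := by
  intro t ht r hr
  have hτ : 0 < τ := ht.1.trans_lt ht.2
  have key : ∀ ε > 0, V - ε ≤ ut r t ∧ ut r t ≤ W + ε := by
    intro ε hε
    obtain ⟨δ, hδ, hδτ, hexp⟩ := unif_expand hτ hc hu.dt hε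
    set η := min δ (τ - t) with hη
    have hηpos : 0 < η := lt_min hδ (by linarith [ht.2])
    have hq : ∀ h ∈ Ioo 0 η, (V - ε) * h ≤ u r (t + h) - u r t ∧ u r (t + h) - u r t ≤ (W + ε) * h := by
      intro h hh
      have h1 : h ≤ δ := hh.2.le.trans (min_le_left _ _)
      have h2 : h ≤ τ - t := hh.2.le.trans (min_le_right _ _)
      have hA : SolOn N α b k t u ur urr ut := hu.mono ht.2.le
      have hB := (hu.mono (τ' := t + h) (by linarith)).shift hh.1.le
      have c1 := comparison hα hB hA ht.1 (C := (W + ε) * h) (fun x hx => by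
        have e1 := (hexp h ⟨hh.1.le, h1⟩ x hx).1
        have e2 := mul_le_mul_of_nonneg_right (add_le_add_left (h0 x hx).2 ε) hh.1.le
        simp only [zero_add]; linarith) t ⟨ht.1, le_rfl⟩ r hr
      have c2 := comparison hα hA hB ht.1 (C := -((V - ε) * h)) (fun x hx => by
        have e1 := (hexp h ⟨hh.1.le, h1⟩ x hx).2
        have e2 := mul_le_mul_of_nonneg_right (sub_le_sub_right (h0 x hx).1 ε) hh.1.le
        simp only [zero_add]; linarith) t ⟨ht.1, le_rfl⟩ r hr
      exact ⟨by linarith, c1⟩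
    have hη2 : η ≤ τ - t := min_le_right _ _
    have hd : HasDerivWithinAt (fun s => u r s) (ut r t) (Ioo t (t + η)) t :=
      (hu.dt r hr t ⟨ht.1, ht.2.le⟩).mono (fun x hx => ⟨by linarith [ht.1, hx.1], by linarith [hx.2]⟩)
    have hs := (hasDerivWithinAt_iff_tendsto_slope' (by simp)).1 hd
    have : (𝓝[Ioo t (t + η)] t).NeBot := by
      rw [← mem_closure_iff_nhdsWithin_neBot, closure_Ioo (by linarith)]
      exact ⟨le_rfl, by linarith⟩
    constructor
    · refine ge_of_tendsto hs ?_
      filter_upwards [self_mem_nhdsWithin] with x hx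
      have := (hq (x - t) ⟨by linarith [hx.1], by linarith [hx.2]⟩).1
      rw [add_sub_cancel] at this
      rw [slope_def_field, le_div_iff₀ (by linarith [hx.1])]
      exact this
    · refine le_of_tendsto hs ?_
      filter_upwards [self_mem_nhdsWithin] with x hx
      have := (hq (x - t) ⟨by linarith [hx.1], by linarith [hx.2]⟩).2
      rw [add_sub_cancel] at this
      rw [slope_def_field, div_le_iff₀ (by linarith [hx.1])]
      exact this
  exact ⟨le_of_forall_pos_le_add fun ε hε => by linarith [(key ε hε).1],
    le_of_forall_pos_le_add fun ε hε => (key ε hε).2⟩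

lemma profile_zero {N : ℕ} {α b c R : ℝ} (hR : 0 < R) (hα : 0 < α) (hcb : 0 < c - b)
    {φ φ' φ'' : ℝ → ℝ}
    (h : IsProfileSolOn N α b c (Ico 0 R) φ φ' φ'') :
    (N : ℝ) * φ'' 0 = (c - b) ^ (1 / α) := by
  obtain ⟨_, h0, _, hd, heq⟩ := h
  have h0m : (0:ℝ) ∈ Ico 0 R := ⟨le_rfl, hR⟩
  have hle : 𝓝[>] (0:ℝ) ≤ 𝓝[Ico 0 R \ {0}] 0 := by
    rw [← nhdsWithin_Ioo_eq_nhdsGT hR]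
    exact nhdsWithin_mono _ fun x hx => ⟨⟨hx.1.le, hx.2⟩, by simpa using hx.1.ne'⟩
  have hs := (hasDerivWithinAt_iff_tendsto_slope.1 (hd 0 h0m)).mono_left hle
  have hct : Tendsto φ' (𝓝[>] 0) (𝓝 (φ' 0)) :=
    (hd 0 h0m).continuousWithinAt.tendsto.mono_left (hle.trans (nhdsWithin_mono _ sdiff_subset))
  rw [h0] at hct
  have hsq : Tendsto (fun r => Real.sqrt (1 + φ' r ^ 2)) (𝓝[>] 0) (𝓝 (Real.sqrt (1 + 0 ^ 2))) :=
    (tendsto_const_nhds.add (hct.pow 2)).sqrt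
  have hX : Tendsto (fun r => c / Real.sqrt (1 + φ' r ^ 2) - b) (𝓝[>] 0) (𝓝 (c - b)) := by
    have := (tendsto_const_nhds (x := c)).div hsq (by simp) |>.sub_const b
    simpa using this
  have hO : Tendsto (fun r => oddPow (c / Real.sqrt (1 + φ' r ^ 2) - b) (1 / α)) (𝓝[>] 0)
      (𝓝 ((c - b) ^ (1 / α))) := by
    refine (hX.rpow_const (p := 1 / α) (Or.inl hcb.ne')).congr' ?_
    filter_upwards [hX.eventually (lt_mem_nhds hcb)] with r hr
    rw [oddPow_pos' hr.le]
  have hfull : Tendsto (fun r => (1 + φ' r ^ 2) * (oddPow (c / Real.sqrt (1 + φ' r ^ 2) - b) (1 / α)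
      * Real.sqrt (1 + φ' r ^ 2) - ((N : ℝ) - 1) * slope φ' 0 r)) (𝓝[>] 0)
      (𝓝 ((1 + 0 ^ 2) * ((c - b) ^ (1 / α) * Real.sqrt (1 + 0 ^ 2) - ((N : ℝ) - 1) * φ'' 0))) :=
    (tendsto_const_nhds.add (hct.pow 2)).mul ((hO.mul hsq).sub (hs.const_mul _))
  have hdd : ∀ r ∈ Ioo 0 R, HasDerivAt φ' (φ'' r) r := fun r hr =>
    (hd r ⟨hr.1.le, hr.2⟩).hasDerivAt (Ico_mem_nhds hr.1 hr.2)
  have hlim : Tendsto (fun r => deriv φ' r) (𝓝[>] 0)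
      (𝓝 ((1 + 0 ^ 2) * ((c - b) ^ (1 / α) * Real.sqrt (1 + 0 ^ 2) - ((N : ℝ) - 1) * φ'' 0))) := by
    refine hfull.congr' ?_
    filter_upwards [Ioo_mem_nhdsGT hR] with r hr
    rw [(hdd r hr).deriv, slope_def_field, h0, sub_zero, sub_zero]
    have h1 := heq r ⟨hr.1.le, hr.2⟩ hr.1.ne'
    rw [← h1]
    have : (0:ℝ) < 1 + φ' r ^ 2 := by positivity
    have hr0 := hr.1.ne'
    field_simp
    ring
  have hD := hasDerivWithinAt_Ici_of_tendsto_deriv (s := Ioo 0 R) (a := 0)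
    (fun r hr => (hdd r hr).differentiableAt.differentiableWithinAt)
    ((hd 0 h0m).continuousWithinAt.mono Ioo_subset_Ico_self) (Ioo_mem_nhdsGT hR) hlim
  have hD2 : HasDerivWithinAt φ' (φ'' 0) (Ici 0) 0 :=
    (hd 0 h0m).mono_of_mem_nhdsWithin (Ico_mem_nhdsGE hR)
  have := (uniqueDiffWithinAt_Ici (0:ℝ)).eq_deriv _ hD hD2
  simp only [one_div]
  simp at this
  linarith

lemma profile_eqn {N : ℕ} {α b c R : ℝ} (hR : 0 < R) (hα : 0 < α) (hc : 0 < c) (hb : b ≤ 0)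
    {φ φ' φ'' : ℝ → ℝ}
    (h : IsProfileSolOn N α b c (Ico 0 R) φ φ' φ'') :
    ∀ r ∈ Ico 0 R, c = speedF N α b r (φ' r) (φ'' r) := by
  intro r hr
  have hD : (0:ℝ) < 1 + φ' r ^ 2 := by positivity
  have hS := Real.sqrt_pos.2 hD
  have hX : 0 < c / Real.sqrt (1 + φ' r ^ 2) - b := by
    have := div_pos hc hS
    linarith
  have hm : meanCurv N r (φ' r) (φ'' r) = (c / Real.sqrt (1 + φ' r ^ 2) - b) ^ (1 / α) := by
    rcases eq_or_lt_of_le hr.1 with h0 | hpos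
    · subst h0
      rw [h.2.1]
      simp only [meanCurv, if_true]
      rw [profile_zero hR hα (by linarith) h]
      simp
    · have h1 := h.2.2.2.2 r hr hpos.ne'
      rw [oddPow_pos' hX.le] at h1
      simp only [meanCurv, if_neg hpos.ne', rpow_three_half]
      rw [← mul_right_cancel_iff_of_pos hS, ← h1]
      field_simp
  rw [speedF, hm, oddPow_pos' (by positivity), ← Real.rpow_mul hX.le, one_div,
    inv_mul_cancel₀ hα.ne', Real.rpow_one]
  field_simp
  ring

lemma profile_sol {N : ℕ} {α b c R k τ : ℝ} (hR : 1 < R) (hα : 0 < α) (hc : 0 < c) (hb : b ≤ 0)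
    {φ φ' φ'' : ℝ → ℝ} (h : IsProfileSolOn N α b c (Ico 0 R) φ φ' φ'') (hk : φ' 1 = k) :
    SolOn N α b k τ (fun r t => φ r + c * t) (fun r _ => φ' r) (fun r _ => φ'' r) (fun _ _ => c) := by
  have hsub : Icc (0:ℝ) 1 ⊆ Ico 0 R := fun x hx => ⟨hx.1, hx.2.trans_lt hR⟩
  have hφ : ContinuousOn φ (Icc 0 1) := fun r hr => ((h.2.2.1 r (hsub hr)).mono hsub).continuousWithinAt
  refine ⟨?_, fun t _ r hr => ?_, fun t _ r hr => ?_, fun r hr t ht => ?_, fun t _ => ⟨h.2.1, hk⟩,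
    fun t _ r hr => profile_eqn (by linarith) hα hc hb h r (hsub hr)⟩
  · exact (hφ.comp continuousOn_fst fun p hp => hp.1).add (by fun_prop)
  · exact ((h.2.2.1 r (hsub hr)).mono hsub).add_const _
  · exact (h.2.2.2.1 r (hsub hr)).mono hsub
  · have := ((hasDerivWithinAt_id t (Icc 0 τ)).const_mul c).const_add (φ r)
    simpa using this

lemma flow_sol {N : ℕ} {α b k : ℝ} (hα : 0 < α) {u₀ u₀' u₀'' : ℝ → ℝ} {I : Set ℝ} {u ur urr ut : ℝ → ℝ → ℝ}
    (h : IsFlowSol N α b k u₀ u₀' u₀'' I u ur urr ut)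
    (hpos : ∀ t ∈ I, ∀ r ∈ Set.Icc (0 : ℝ) 1, 0 < meanCurv N r (ur r t) (urr r t))
    {τ : ℝ} (hI : Icc 0 τ ⊆ I) : SolOn N α b k τ u ur urr ut := by
  obtain ⟨hc, hcr, hcrr, hct, hr, hrr, ht, hi, hbd, he⟩ := h
  refine ⟨hc.mono (prod_mono le_rfl hI), fun t ht => hr t (hI ht), fun t ht => hrr t (hI ht),
    fun r hr t h => (ht r hr t (hI h)).mono hI, fun t ht => hbd t (hI ht), fun t htt r hrm => ?_⟩
  have htI := hI htt
  rcases eq_or_lt_of_le hrm.1 with h0 | h0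
  · subst h0
    have hsl : ∀ {f : ℝ → ℝ → ℝ}, ContinuousOn (fun p : ℝ × ℝ => f p.1 p.2) (Set.Icc 0 1 ×ˢ I) →
        ContinuousOn (fun r => f r t) (Icc 0 1) := fun hf =>
      hf.comp (f := fun r : ℝ => (r, t)) (by fun_prop) (fun r hr => ⟨hr, htI⟩)
    have hm := meanCurv_cont N (hbd t htI).1 (hrr t htI) (hsl hcrr)
    have hF : ContinuousOn (fun r => speedF N α b r (ur r t) (urr r t)) (Icc 0 1) := by
      unfold speedF
      refine ContinuousOn.mul (ContinuousOn.add ?_ continuousOn_const)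
        (continuousOn_const.add ((hsl hcr).pow 2)).sqrt
      refine (hm.rpow_const (p := α) (fun r hr => Or.inr hα.le)).congr fun r hr => ?_
      exact oddPow_pos' (hpos t htI r hr).le α
    have hle : 𝓝[>] (0:ℝ) ≤ 𝓝[Icc 0 1] 0 := by
      rw [← nhdsWithin_Ioo_eq_nhdsGT (zero_lt_one (α := ℝ))]
      exact nhdsWithin_mono _ Ioo_subset_Icc_self
    have t1 := (hF 0 hrm).tendsto.mono_left hle
    have t2 := (hsl hct 0 hrm).tendsto.mono_left hle
    refine tendsto_nhds_unique t2 (t1.congr' ?_)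
    filter_upwards [Ioo_mem_nhdsGT (zero_lt_one (α := ℝ))] with r hr
    exact (he t htI r ⟨hr.1, hr.2.le⟩).symm
  · exact he t htI r ⟨h0, hrm.2⟩

/-- a priori estimates, case `b ≤ 0 < k`: there are positive constants,
depending only on the data (not on `T`), bounding `u − c̃t`, `u_r`, `u_t`, `H` and
`u_rr` for every classical solution on `[0, T)` with positive mean curvature. -/
theorem stmt15 (N : ℕ) (hN : 1 < N) (α b k : ℝ) (hα : 0 < α) (hb : b ≤ 0) (hk : 0 < k)
    (hbk : (-b) ^ (1 / α) * Real.sqrt (1 + k ^ 2) < k * (N : ℝ))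
    (u₀ u₀' u₀'' : ℝ → ℝ) (hdata : IsC2Data k u₀ u₀' u₀'')
    (hH0 : ∀ r ∈ Set.Icc (0 : ℝ) 1,
      0 < meanCurv N r (u₀' r) (u₀'' r) ∧
      0 < oddPow (meanCurv N r (u₀' r) (u₀'' r)) α + b)
    (ct RΦ : ℝ) (Φ Φ' Φ'' : ℝ → ℝ) (hct : 0 < ct)
    (hΦ : IsMaxProfileSol N α b ct RΦ Φ Φ' Φ'') (hRΦ : 1 < RΦ) (hΦk : Φ' 1 = k) :
    ∃ M₀ M₁ M₂ Vlo Vhi Hlo Hhi : ℝ,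
      0 < M₀ ∧ 0 < M₁ ∧ 0 < M₂ ∧ 0 < Vlo ∧ 0 < Vhi ∧ 0 < Hlo ∧ 0 < Hhi ∧
      ∀ T : ℝ≥0∞, 0 < T → ∀ u ur urr ut : ℝ → ℝ → ℝ,
        IsFlowSol N α b k u₀ u₀' u₀'' (timeSet T) u ur urr ut →
        (∀ t ∈ timeSet T, ∀ r ∈ Set.Icc (0 : ℝ) 1,
          0 < meanCurv N r (ur r t) (urr r t)) →
        ∀ t ∈ timeSet T,
          (∀ r ∈ Set.Icc (0 : ℝ) 1, |u r t - ct * t| ≤ M₀) ∧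
          (∀ r ∈ Set.Ioc (0 : ℝ) 1, 0 < ur r t ∧ ur r t ≤ M₁) ∧
          (∀ r ∈ Set.Icc (0 : ℝ) 1, Vlo ≤ ut r t ∧ ut r t ≤ Vhi) ∧
          (∀ r ∈ Set.Ioc (0 : ℝ) 1,
            Hlo ≤ meanCurv N r (ur r t) (urr r t) ∧
            meanCurv N r (ur r t) (urr r t) ≤ Hhi) ∧
          (∀ r ∈ Set.Icc (0 : ℝ) 1, |urr r t| ≤ M₂) := by
  obtain ⟨hd1, hd2, hcc, hz, hone⟩ := hdata
  have hp0c : ContinuousOn u₀' (Icc 0 1) := fun r hr => (hd2 r hr).continuousWithinAt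
  have hu0c : ContinuousOn u₀ (Icc 0 1) := fun r hr => (hd1 r hr).continuousWithinAt
  have hF : ContinuousOn (fun r => speedF N α b r (u₀' r) (u₀'' r)) (Icc 0 1) := by
    unfold speedF
    refine ContinuousOn.mul (ContinuousOn.add ?_ continuousOn_const)
      (continuousOn_const.add (hp0c.pow 2)).sqrt
    refine ((meanCurv_cont N hz hd2 hcc).rpow_const (p := α)
      (fun r hr => Or.inr hα.le)).congr fun r hr => ?_
    exact oddPow_pos' (hH0 r hr).1.le α
  have hne : (Icc (0:ℝ) 1).Nonempty := nonempty_Icc.2 zero_le_one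
  obtain ⟨ra, hra, hmin⟩ := isCompact_Icc.exists_isMinOn hne hF
  obtain ⟨rb, hrb, hmax⟩ := isCompact_Icc.exists_isMaxOn hne hF
  set Vlo := speedF N α b ra (u₀' ra) (u₀'' ra) with hVlo
  set Vhi := speedF N α b rb (u₀' rb) (u₀'' rb) with hVhi
  have hVpos : 0 < Vlo := by
    rw [hVlo, speedF]
    exact mul_pos (hH0 ra hra).2 (by positivity)
  have hVV : Vlo ≤ Vhi := hmin hrb
  have hVhpos : 0 < Vhi := hVpos.trans_le hVV
  obtain ⟨c0, hc0, hc0'⟩ := exists_c0 N (α := α) (b := b) (k := k) (V := Vhi) hα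
  set M₁ := max k (1 / c0) with hM1
  have hM1pos : 0 < M₁ := hk.trans_le (le_max_left _ _)
  have hsub : Icc (0:ℝ) 1 ⊆ Ico 0 RΦ := fun x hx => ⟨hx.1, hx.2.trans_lt hRΦ⟩
  have hΦc : ContinuousOn Φ (Icc 0 1) := fun r hr =>
    ((hΦ.2.1.2.2.1 r (hsub hr)).mono hsub).continuousWithinAt
  obtain ⟨C, hC⟩ := isCompact_Icc.exists_bound_of_continuousOn (hu0c.sub hΦc)
  obtain ⟨D, hD⟩ := isCompact_Icc.exists_bound_of_continuousOn hΦc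
  have h0I : (0:ℝ) ∈ Icc (0:ℝ) 1 := ⟨le_rfl, zero_le_one⟩
  have hCn : 0 ≤ C := (norm_nonneg _).trans (hC 0 h0I)
  have hDn : 0 ≤ D := (norm_nonneg _).trans (hD 0 h0I)
  have hHhpos : 0 < (Vhi - b) ^ (1 / α) := Real.rpow_pos_of_pos (by linarith) _
  refine ⟨C + D + 1, M₁, (1 + M₁ ^ 2) ^ ((3:ℝ) / 2) * (2 * (Vhi - b) ^ (1 / α)), Vlo, Vhi,
    (Vlo / Real.sqrt (1 + M₁ ^ 2)) ^ (1 / α), (Vhi - b) ^ (1 / α), by linarith, hM1pos,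
    by positivity, hVpos, hVhpos, by positivity, hHhpos, ?_⟩
  intro T hT u ur urr ut hflow hHpos t ht
  obtain ⟨τ, htτ, hτ⟩ : ∃ τ, t < τ ∧ Icc 0 τ ⊆ timeSet T := by
    obtain ⟨y, hy1, hy2⟩ := ENNReal.lt_iff_exists_nnreal_btwn.1 ht.2
    refine ⟨y, ?_, fun s hs => ⟨hs.1, ?_⟩⟩
    · have := (ENNReal.ofReal_lt_iff_lt_toReal ht.1 ENNReal.coe_ne_top).1 hy1
      simpa using this
    · refine lt_of_le_of_lt (ENNReal.ofReal_le_ofReal hs.2) ?_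
      simpa using hy2
  have hsol : SolOn N α b k τ u ur urr ut := flow_sol hα hflow hHpos hτ
  have ht0 : 0 ≤ t := ht.1
  have hτ0 : 0 ≤ τ := ht0.trans htτ.le
  have htm : t ∈ Icc 0 τ := ⟨ht0, htτ.le⟩
  have hstart := hflow.2.2.2.2.2.2.2.1
  have hut := ut_bounds hα hsol (hflow.2.2.2.1.mono (prod_mono le_rfl hτ)) (V := Vlo) (W := Vhi)
    (fun r hr => by
      rw [hsol.eqn 0 ⟨le_rfl, hτ0⟩ r hr, (hstart r hr).2.1, (hstart r hr).2.2]
      exact ⟨hmin hr, hmax hr⟩) t ⟨ht0, htτ⟩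
  have hdp := hsol.drr t htm
  have hHt := hHpos t ht
  have hppos := slope_pos hN hdp (fun r hr => hHt r ⟨hr.1.le, hr.2.le⟩)
  have hS1 : ∀ x : ℝ, 1 ≤ Real.sqrt (1 + x ^ 2) := fun x =>
    Real.one_le_sqrt.2 (by nlinarith [sq_nonneg x])
  -- mean curvature in terms of the speed
  have hHeq : ∀ r ∈ Icc (0:ℝ) 1, meanCurv N r (ur r t) (urr r t)
      = (ut r t * (1 / Real.sqrt (1 + ur r t ^ 2)) - b) ^ (1 / α) := by
    intro r hr
    have hS : 0 < Real.sqrt (1 + ur r t ^ 2) := by linarith [hS1 (ur r t)]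
    have he := hsol.eqn t htm r hr
    rw [speedF, oddPow_pos' (hHt r hr).le] at he
    have : ut r t * (1 / Real.sqrt (1 + ur r t ^ 2)) - b = meanCurv N r (ur r t) (urr r t) ^ α := by
      rw [he]; field_simp; ring
    rw [this, ← Real.rpow_mul (hHt r hr).le, mul_one_div_cancel hα.ne', Real.rpow_one]
  have hα1 : 0 ≤ 1 / α := by positivity
  have hHub : ∀ r ∈ Icc (0:ℝ) 1, meanCurv N r (ur r t) (urr r t) ≤
      (Vhi * (1 / Real.sqrt (1 + ur r t ^ 2)) - b) ^ (1 / α) := by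
    intro r hr
    rw [hHeq r hr]
    have hS : 0 < 1 / Real.sqrt (1 + ur r t ^ 2) := by positivity
    have h1 := mul_le_mul_of_nonneg_right (hut r hr).2 hS.le
    have h2 := mul_pos (hVpos.trans_le (hut r hr).1) hS
    exact Real.rpow_le_rpow (by linarith) (by linarith) hα1
  have hHlb : ∀ r ∈ Icc (0:ℝ) 1, (-b) ^ (1 / α) ≤ meanCurv N r (ur r t) (urr r t) := by
    intro r hr
    rw [hHeq r hr]
    have hS : 0 < 1 / Real.sqrt (1 + ur r t ^ 2) := by positivity
    have h2 := mul_pos (hVpos.trans_le (hut r hr).1) hS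
    exact Real.rpow_le_rpow (by linarith) (by linarith) hα1
  have hgrad := grad_bound hN hk hc0 hc0' (hsol.bdy t htm).1 (hsol.bdy t htm).2 hdp
    (fun r hr => hHlb r ⟨hr.1.le, hr.2.le⟩) (fun r hr => hHub r ⟨hr.1.le, hr.2.le⟩)
  have hHhi : ∀ r ∈ Icc (0:ℝ) 1, meanCurv N r (ur r t) (urr r t) ≤ (Vhi - b) ^ (1 / α) := by
    intro r hr
    refine (hHub r hr).trans ?_
    have hS : 1 / Real.sqrt (1 + ur r t ^ 2) ≤ 1 := by
      rw [div_le_one (by positivity)]; exact hS1 _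
    have hS' : 0 < 1 / Real.sqrt (1 + ur r t ^ 2) := by positivity
    have h1 := mul_le_mul_of_nonneg_left hS hVhpos.le
    have h2 := mul_pos hVhpos hS'
    exact Real.rpow_le_rpow (by linarith) (by linarith) hα1
  have hsq : ∀ r ∈ Ioc (0:ℝ) 1, 1 + ur r t ^ 2 ≤ 1 + M₁ ^ 2 := by
    intro r hr
    have h1 := hppos r hr
    have h2 := hgrad r ⟨hr.1.le, hr.2⟩
    have := pow_le_pow_left₀ h1.le h2 2
    linarith
  have hurr : ∀ r ∈ Ioc (0:ℝ) 1,
      |urr r t| ≤ (1 + M₁ ^ 2) ^ ((3:ℝ) / 2) * (2 * (Vhi - b) ^ (1 / α)) := by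
    intro r hr
    have hrI : r ∈ Icc (0:ℝ) 1 := ⟨hr.1.le, hr.2⟩
    have hA : (0:ℝ) < (1 + ur r t ^ 2) ^ ((3 : ℝ) / 2) := by positivity
    have hAle : (1 + ur r t ^ 2) ^ ((3 : ℝ) / 2) ≤ (1 + M₁ ^ 2) ^ ((3:ℝ) / 2) :=
      Real.rpow_le_rpow (by positivity) (hsq r hr) (by norm_num)
    have hfl := flux_anti hN ((Vhi - b) ^ (1 / α)) hdp (fun r hr => hHhi r ⟨hr.1.le, hr.2.le⟩)
      h0I hrI hr.1.le
    rw [flux_zero hN] at hfl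
    simp only [flux] at hfl
    have hN0 : (0:ℝ) < N := by positivity
    have hN1 : (1:ℝ) < N := by exact_mod_cast hN
    have hpow : r ^ N = r ^ (N - 1) * r := by
      rw [← pow_succ]; congr 1; omega
    have hS : 0 < Real.sqrt (1 + ur r t ^ 2) := by positivity
    have hy : 0 < r ^ (N - 1) := pow_pos hr.1 _
    rw [hpow] at hfl
    have hle : ur r t / Real.sqrt (1 + ur r t ^ 2) ≤ (Vhi - b) ^ (1 / α) * r / N := by
      have : r ^ (N - 1) * (ur r t / Real.sqrt (1 + ur r t ^ 2)) ≤
          r ^ (N - 1) * ((Vhi - b) ^ (1 / α) * r / N) := by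
        have e : (Vhi - b) ^ (1 / α) * (r ^ (N - 1) * r) / (N:ℝ)
          = r ^ (N - 1) * ((Vhi - b) ^ (1 / α) * r / N) := by ring
        rw [e] at hfl
        linarith
      exact le_of_mul_le_mul_left this hy
    have hX : ((N:ℝ) - 1) * ur r t / (r * Real.sqrt (1 + ur r t ^ 2)) ≤ (Vhi - b) ^ (1 / α) := by
      have e : ((N:ℝ) - 1) * ur r t / (r * Real.sqrt (1 + ur r t ^ 2))
          = ((N:ℝ) - 1) / r * (ur r t / Real.sqrt (1 + ur r t ^ 2)) := by
        field_simp
      rw [e]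
      have hc : 0 ≤ ((N:ℝ) - 1) / r := div_nonneg (by linarith) hr.1.le
      refine (mul_le_mul_of_nonneg_left hle hc).trans ?_
      have hr0 := hr.1.ne'
      have e2 : ((N:ℝ) - 1) / r * ((Vhi - b) ^ (1 / α) * r / N)
          = (Vhi - b) ^ (1 / α) * (((N:ℝ) - 1) / N) := by field_simp
      rw [e2]
      have : ((N:ℝ) - 1) / N ≤ 1 := by rw [div_le_one hN0]; linarith
      exact mul_le_of_le_one_right hHhpos.le this
    have hX0 : 0 ≤ ((N:ℝ) - 1) * ur r t / (r * Real.sqrt (1 + ur r t ^ 2)) :=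
      div_nonneg (mul_nonneg (by linarith) (hppos r hr).le) (mul_nonneg hr.1.le hS.le)
    have hm : meanCurv N r (ur r t) (urr r t) = urr r t / (1 + ur r t ^ 2) ^ ((3 : ℝ) / 2)
        + ((N : ℝ) - 1) * ur r t / (r * Real.sqrt (1 + ur r t ^ 2)) := by
      simp [meanCurv, hr.1.ne']
    have h1 := hHt r hrI
    have h2 := hHhi r hrI
    have hq : |urr r t / (1 + ur r t ^ 2) ^ ((3 : ℝ) / 2)| ≤ 2 * (Vhi - b) ^ (1 / α) := by
      rw [abs_le]
      constructor <;> linarith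
    rw [abs_div, abs_of_pos hA, div_le_iff₀ hA] at hq
    refine hq.trans ?_
    rw [mul_comm]
    exact mul_le_mul_of_nonneg_right hAle (by positivity)
  refine ⟨?_, fun r hr => ⟨hppos r hr, hgrad r ⟨hr.1.le, hr.2⟩⟩, hut, ?_, ?_⟩
  · intro r hr
    have hP := profile_sol (τ := τ) hRΦ hα hct hb hΦ.2.1 hΦk
    have hCa : ∀ x ∈ Icc (0:ℝ) 1, |u₀ x - Φ x| ≤ C := hC
    have c1 := comparison hα hsol hP hτ0 (C := C) (fun x hx => by
      rw [(hstart x hx).1]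
      have := (abs_le.1 (hCa x hx)).2
      simp only [mul_zero, add_zero]; exact this) t htm r hr
    have c2 := comparison hα hP hsol hτ0 (C := C) (fun x hx => by
      rw [(hstart x hx).1]
      have := (abs_le.1 (hCa x hx)).1
      simp only [mul_zero, add_zero]; linarith) t htm r hr
    have hDr := abs_le.1 (show |Φ r| ≤ D from hD r hr)
    rw [abs_le]
    constructor <;> linarith [hDr.1, hDr.2]
  · intro r hr
    have hrI : r ∈ Icc (0:ℝ) 1 := ⟨hr.1.le, hr.2⟩
    refine ⟨?_, hHhi r hrI⟩
    rw [hHeq r hrI]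
    refine Real.rpow_le_rpow (by positivity) ?_ hα1
    have h1 : Real.sqrt (1 + ur r t ^ 2) ≤ Real.sqrt (1 + M₁ ^ 2) := Real.sqrt_le_sqrt (hsq r hr)
    have hS : 0 < Real.sqrt (1 + ur r t ^ 2) := by positivity
    have h2 : Vlo / Real.sqrt (1 + M₁ ^ 2) ≤ ut r t / Real.sqrt (1 + ur r t ^ 2) :=
      div_le_div₀ (hVpos.le.trans (hut r hrI).1) (hut r hrI).1 hS h1
    rw [mul_one_div]
    linarith
  · intro r hr
    rcases eq_or_lt_of_le hr.1 with h | h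
    · subst h
      have hcs : ContinuousOn (fun r => urr r t) (Icc 0 1) :=
        hflow.2.2.1.comp (f := fun r : ℝ => (r, t)) (by fun_prop) (fun r hr => ⟨hr, ht⟩)
      have hle : 𝓝[>] (0:ℝ) ≤ 𝓝[Icc 0 1] 0 := by
        rw [← nhdsWithin_Ioo_eq_nhdsGT (zero_lt_one (α := ℝ))]
        exact nhdsWithin_mono _ Ioo_subset_Icc_self
      refine le_of_tendsto ((hcs 0 h0I).tendsto.mono_left hle).abs ?_
      filter_upwards [Ioo_mem_nhdsGT (zero_lt_one (α := ℝ))] with x hx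
      exact hurr x ⟨hx.1, hx.2.le⟩
    · exact hurr r ⟨h, hr.2⟩
end

section
/- Let N > 1 be an integer, α > 0, b > 0 and k > 0, and fix initial data u₀ ∈ C²([0,1]) with u₀'(0) = 0, u₀'(1) = k and u₀''(r) > 0 for all r ∈ [0,1]. Then there exists H_* > 0, depending only on N, α, b, k and u₀ (and not on T₀), such that for every T₀ ∈ (0, ∞] and every classical solution u of the flow on [0, T₀) with initial data u₀ and with H(r,t) > 0 throughout, one has H(r,t) ≥ H_* for all r ∈ (0,1] and t ∈ [0, T₀). -/
open Set Filter Topology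

open scoped ENNReal

/-- At a minimum located at the right endpoint, the derivative is nonpositive. -/
lemma deriv_nonpos_right_end (f : ℝ → ℝ) (f' a c : ℝ) (hac : a < c)
    (hf : HasDerivWithinAt f f' (Icc a c) c) (hmin : ∀ s ∈ Icc a c, f c ≤ f s) : f' ≤ 0 := by
  have h1 : HasDerivWithinAt f f' (Ioo a c) c := hf.mono Ioo_subset_Icc_self
  rw [hasDerivWithinAt_iff_tendsto_slope' (by simp)] at h1
  have : (𝓝[Ioo a c] c).NeBot := by
    rw [nhdsWithin_Ioo_eq_nhdsLT hac]; infer_instance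
  refine le_of_tendsto h1 ?_
  filter_upwards [self_mem_nhdsWithin] with s hs
  rw [slope_def_field]
  have := hmin s ⟨hs.1.le, hs.2.le⟩
  exact div_nonpos_of_nonneg_of_nonpos (by linarith) (by linarith [hs.2])

/-- At a minimum located at the left endpoint, the derivative is nonnegative. -/
lemma deriv_nonneg_left_end (f : ℝ → ℝ) (f' a c : ℝ) (hac : a < c)
    (hf : HasDerivWithinAt f f' (Icc a c) a) (hmin : ∀ s ∈ Icc a c, f a ≤ f s) : 0 ≤ f' := by
  have h1 : HasDerivWithinAt f f' (Ioo a c) a := hf.mono Ioo_subset_Icc_self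
  rw [hasDerivWithinAt_iff_tendsto_slope' (by simp)] at h1
  have : (𝓝[Ioo a c] a).NeBot := by
    rw [nhdsWithin_Ioo_eq_nhdsGT hac]; infer_instance
  refine ge_of_tendsto h1 ?_
  filter_upwards [self_mem_nhdsWithin] with s hs
  rw [slope_def_field]
  have := hmin s ⟨hs.1.le, hs.2.le⟩
  exact div_nonneg (by linarith) (by linarith [hs.1])

/-- First and second derivative tests at an interior minimum. -/
lemma second_deriv_test (w w' : ℝ → ℝ) (a c x d : ℝ) (hx : x ∈ Ioo a c)
    (hw : ∀ s ∈ Ioo a c, HasDerivAt w (w' s) s) (hw' : HasDerivAt w' d x)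
    (hmin : ∀ s ∈ Ioo a c, w x ≤ w s) : w' x = 0 ∧ 0 ≤ d := by
  have hloc : IsLocalMin w x := by
    filter_upwards [Ioo_mem_nhds hx.1 hx.2] with s hs using hmin s hs
  have h0 : w' x = 0 := hloc.hasDerivAt_eq_zero (hw x hx)
  refine ⟨h0, ?_⟩
  by_contra hd
  push Not at hd
  have h1 := hw'.tendsto_slope
  have h2 : ∀ᶠ s in 𝓝[>] x, slope w' x s < 0 :=
    (h1.mono_left (nhdsWithin_mono x (fun s hs => ne_of_gt hs))).eventually (gt_mem_nhds hd)
  have h3 : ∀ᶠ s in 𝓝[>] x, w' s < 0 := by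
    filter_upwards [h2, self_mem_nhdsWithin] with s hs hs'
    rw [slope_def_field, h0, sub_zero] at hs
    have hs'' : 0 < s - x := sub_pos.2 hs'
    by_contra hcon
    push Not at hcon
    exact absurd (div_nonneg hcon hs''.le) (not_le.2 hs)
  obtain ⟨y, hy, hyw⟩ := (mem_nhdsGT_iff_exists_Ioo_subset).1 h3
  have hy' : x < y := hy
  set z := min ((x + y) / 2) ((x + c) / 2) with hz
  have hz1 : x < z := lt_min (by linarith) (by linarith [hx.2])
  have hz2 : z < y := lt_of_le_of_lt (min_le_left _ _) (by linarith)
  have hz3 : z < c := lt_of_le_of_lt (min_le_right _ _) (by linarith [hx.2])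
  obtain ⟨ξ, hξ, hξe⟩ := exists_hasDerivAt_eq_slope w w' hz1
    (fun s hs => (hw s ⟨by linarith [hx.1, hs.1], by linarith [hs.2]⟩).continuousAt.continuousWithinAt)
    (fun s hs => hw s ⟨by linarith [hx.1, hs.1], by linarith [hs.2]⟩)
  have h4 : w' ξ < 0 := hyw ⟨hξ.1, by linarith [hξ.2]⟩
  rw [hξe] at h4
  have h5 := hmin z ⟨by linarith [hx.1], hz3⟩
  exact absurd (div_nonneg (by linarith) (by linarith)) (not_le.2 h4)

/-- Mean value theorem for one-sided derivatives on an interval. -/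
lemma mvt_within (f f' : ℝ → ℝ) (a c : ℝ) (S : Set ℝ) (hS : Icc a c ⊆ S) (hac : a < c)
    (hf : ∀ s ∈ Icc a c, HasDerivWithinAt f (f' s) S s) :
    ∃ ξ ∈ Ioo a c, f c - f a = f' ξ * (c - a) := by
  obtain ⟨ξ, hξ, hξe⟩ := exists_hasDerivAt_eq_slope f f' hac
    (fun s hs => ((hf s hs).mono hS).continuousWithinAt)
    (fun s hs => ((hf s ⟨hs.1.le, hs.2.le⟩).mono hS).hasDerivAt (Icc_mem_nhds hs.1 hs.2))
  refine ⟨ξ, hξ, ?_⟩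
  rw [hξe, div_mul_cancel₀]
  linarith

/-- Uniform continuity on a space-time rectangle. -/
lemma unif_cont (F : ℝ → ℝ → ℝ) (T1 : ℝ)
    (hF : ContinuousOn (fun p : ℝ × ℝ => F p.1 p.2) (Icc 0 1 ×ˢ Icc 0 T1)) (e : ℝ) (he : 0 < e) :
    ∃ δ > 0, ∀ x ∈ Icc (0:ℝ) 1, ∀ y ∈ Icc (0:ℝ) 1, ∀ t ∈ Icc (0:ℝ) T1, ∀ s ∈ Icc (0:ℝ) T1,
      |x - y| < δ → |t - s| < δ → |F x t - F y s| < e := by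
  have h := (isCompact_Icc.prod isCompact_Icc).uniformContinuousOn_of_continuous hF
  rw [Metric.uniformContinuousOn_iff] at h
  obtain ⟨δ, hδ, h⟩ := h e he
  refine ⟨δ, hδ, fun x hx y hy t ht s hs h1 h2 => ?_⟩
  have := h (x, t) ⟨hx, ht⟩ (y, s) ⟨hy, hs⟩ (by
    rw [Prod.dist_eq, Real.dist_eq, Real.dist_eq]; exact max_lt h1 h2)
  rwa [Real.dist_eq] at this

/-- The minimum principle for `u_t - B u_r - A`, proved with finite differences. -/
lemma key (A B k : ℝ) (hB : 0 < B) (I : Set ℝ)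
    (hI0 : ∀ t ∈ I, 0 ≤ t) (hI1 : ∀ t ∈ I, Icc 0 t ⊆ I) (hI2 : ∀ t ∈ I, ∃ t' ∈ I, t < t')
    (u ur urr ut : ℝ → ℝ → ℝ)
    (hcu : ContinuousOn (fun p : ℝ × ℝ => u p.1 p.2) (Set.Icc 0 1 ×ˢ I))
    (hcur : ContinuousOn (fun p : ℝ × ℝ => ur p.1 p.2) (Set.Icc 0 1 ×ˢ I))
    (hcurr : ContinuousOn (fun p : ℝ × ℝ => urr p.1 p.2) (Set.Icc 0 1 ×ˢ I))
    (hcut : ContinuousOn (fun p : ℝ × ℝ => ut p.1 p.2) (Set.Icc 0 1 ×ˢ I))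
    (hur : ∀ t ∈ I, ∀ r ∈ Set.Icc (0:ℝ) 1,
      HasDerivWithinAt (fun s => u s t) (ur r t) (Set.Icc 0 1) r)
    (hurr : ∀ t ∈ I, ∀ r ∈ Set.Icc (0:ℝ) 1,
      HasDerivWithinAt (fun s => ur s t) (urr r t) (Set.Icc 0 1) r)
    (hut : ∀ r ∈ Set.Icc (0:ℝ) 1, ∀ t ∈ I, HasDerivWithinAt (fun s => u r s) (ut r t) I t)
    (hbd : ∀ t ∈ I, ur 0 t = 0 ∧ ur 1 t = k)
    (hpos : ∀ t ∈ I, ∀ r ∈ Ioc (0:ℝ) 1, 0 < ur r t)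
    (hmono : ∀ t ∈ I, ∀ t' ∈ I, ∀ x ∈ Ioc (0:ℝ) 1, ∀ y ∈ Ioc (0:ℝ) 1, y ≤ x →
      ur y t' = ur x t → urr x t ≤ urr y t' → ut x t ≤ ut y t')
    (hbdry : ∀ t ∈ I, ut 1 t < A + B * k → urr 1 t < 0)
    (hinit : ∀ x ∈ Ioc (0:ℝ) 1, A + B * ur x 0 ≤ ut x 0) :
    ∀ t ∈ I, ∀ x ∈ Ioc (0:ℝ) 1, A + B * ur x t ≤ ut x t := by
  intro t1 ht1 x1 hx1
  by_contra hcon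
  push Not at hcon
  obtain ⟨T1, hT1, htT⟩ := hI2 t1 ht1
  have h0t1 := hI0 t1 ht1
  have hsub : Icc 0 T1 ⊆ I := hI1 T1 hT1
  have hsubK : Icc (0:ℝ) 1 ×ˢ Icc 0 T1 ⊆ Icc (0:ℝ) 1 ×ˢ I := prod_mono le_rfl hsub
  obtain ⟨ε, hε, hεlt⟩ : ∃ ε > 0, ut x1 t1 - B * ur x1 t1 - A < -(4 * ε) :=
    ⟨(A + B * ur x1 t1 - ut x1 t1) / 5, by linarith, by linarith⟩
  -- the boundary curvature is uniformly negative where it matters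
  obtain ⟨η, hη, hηb⟩ : ∃ η > 0, ∀ t ∈ Icc 0 T1, ut 1 t ≤ A + B * k - ε → urr 1 t ≤ -η := by
    have hline : ContinuousOn (fun t : ℝ => ((1:ℝ), t)) (Icc 0 T1) := by fun_prop
    have hm : MapsTo (fun t : ℝ => ((1:ℝ), t)) (Icc 0 T1) (Icc (0:ℝ) 1 ×ˢ I) :=
      fun t ht => ⟨⟨zero_le_one, le_rfl⟩, hsub ht⟩
    have c1 : ContinuousOn (fun t => ut 1 t) (Icc 0 T1) := hcut.comp hline hm
    have c2 : ContinuousOn (fun t => urr 1 t) (Icc 0 T1) := hcurr.comp hline hm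
    set S := Icc 0 T1 ∩ (fun t => ut 1 t) ⁻¹' Iic (A + B * k - ε) with hS
    have hSc : IsCompact S :=
      isCompact_Icc.of_isClosed_subset (c1.preimage_isClosed_of_isClosed isClosed_Icc isClosed_Iic)
        inter_subset_left
    rcases S.eq_empty_or_nonempty with he | hne
    · refine ⟨1, one_pos, fun t ht h => ?_⟩
      exact absurd (show t ∈ S from ⟨ht, h⟩) (by simp [he])
    · obtain ⟨s, hs, hsm⟩ := hSc.exists_isMaxOn hne (c2.mono inter_subset_left)
      have hneg : urr 1 s < 0 := hbdry s (hsub hs.1) (by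
        have : ut 1 s ≤ A + B * k - ε := hs.2
        linarith)
      refine ⟨-urr 1 s, by linarith, fun t ht h => ?_⟩
      have := hsm (show t ∈ S from ⟨ht, h⟩)
      simp only [mem_ofPred_eq] at this
      linarith
  obtain ⟨δ1, hδ1, hU1⟩ := unif_cont ut T1 (hcut.mono hsubK) (ε / 4) (by linarith)
  obtain ⟨δ2, hδ2, hU2⟩ := unif_cont ur T1 (hcur.mono hsubK) (ε / (4 * B)) (by positivity)
  obtain ⟨δ3, hδ3, hU3⟩ := unif_cont urr T1 (hcurr.mono hsubK) η hη
  obtain ⟨δ, hδ, hd1, hd2, hd3⟩ : ∃ δ > 0, δ ≤ δ1 ∧ δ ≤ δ2 ∧ δ ≤ δ3 :=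
    ⟨min δ1 (min δ2 δ3), by positivity, min_le_left _ _,
      (min_le_right _ _).trans (min_le_left _ _), (min_le_right _ _).trans (min_le_right _ _)⟩
  obtain ⟨h, hh, hhδ, hhT, hhB⟩ : ∃ h > 0, h < δ ∧ h < T1 - t1 ∧ B * h < min δ x1 := by
    have hm : 0 < min δ x1 := lt_min hδ hx1.1
    have hp : 0 < min δ (min (T1 - t1) (min δ x1 / B)) := by
      have : 0 < T1 - t1 := by linarith
      positivity
    refine ⟨min δ (min (T1 - t1) (min δ x1 / B)) / 2, by positivity, ?_, ?_, ?_⟩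
    · linarith [min_le_left δ (min (T1 - t1) (min δ x1 / B))]
    · linarith [(min_le_right δ (min (T1 - t1) (min δ x1 / B))).trans (min_le_left _ _)]
    · have h1 := (min_le_right δ (min (T1 - t1) (min δ x1 / B))).trans (min_le_right _ _)
      have h2 : min δ (min (T1 - t1) (min δ x1 / B)) / 2 < min δ x1 / B := by linarith
      rw [lt_div_iff₀ hB] at h2
      linarith
  set ζ := B * h with hζ
  have hζ0 : 0 < ζ := by positivity
  have hζδ : ζ < δ := hhB.trans_le (min_le_left _ _)
  have hζx : ζ < x1 := hhB.trans_le (min_le_right _ _)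
  have hζ1 : ζ < 1 := hζx.trans_le hx1.2
  -- finite difference approximates the derivative
  have happ : ∀ x ∈ Icc ζ 1, ∀ t ∈ Icc 0 t1,
      |(u (x - ζ) (t + h) - u x t) - h * (ut x t - B * ur x t)| ≤ h * (ε / 2) := by
    intro x hx t ht
    have hxI : x ∈ Icc (0:ℝ) 1 := ⟨by linarith [hx.1], hx.2⟩
    have hyI : x - ζ ∈ Icc (0:ℝ) 1 := ⟨by linarith [hx.1], by linarith [hx.2]⟩
    have htI : t ∈ Icc 0 T1 := ⟨ht.1, by linarith [ht.2]⟩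
    obtain ⟨τ, hτ, hτe⟩ := mvt_within (fun s => u (x - ζ) s) (fun s => ut (x - ζ) s) t (t + h) I
      (fun s hs => hsub ⟨by linarith [hs.1, ht.1], by linarith [hs.2, ht.2]⟩) (by linarith)
      (fun s hs => hut _ hyI s (hsub ⟨by linarith [hs.1, ht.1], by linarith [hs.2, ht.2]⟩))
    obtain ⟨ξ, hξ, hξe⟩ := mvt_within (fun s => u s t) (fun s => ur s t) (x - ζ) x (Icc 0 1)
      (fun s hs => ⟨by linarith [hs.1, hx.1], by linarith [hs.2, hx.2]⟩) (by linarith)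
      (fun s hs => hur t (hsub htI) s ⟨by linarith [hs.1, hx.1], by linarith [hs.2, hx.2]⟩)
    have e1 := hU1 (x - ζ) hyI x hxI τ ⟨by linarith [hτ.1, ht.1], by linarith [hτ.2, ht.2]⟩ t htI
      (by rw [abs_lt]; constructor <;> linarith)
      (by rw [abs_lt]; constructor <;> linarith [hτ.1, hτ.2])
    have e2 := hU2 ξ ⟨by linarith [hξ.1, hx.1], by linarith [hξ.2, hx.2]⟩ x hxI t htI t htI
      (by rw [abs_lt]; constructor <;> linarith [hξ.1, hξ.2])
      (by simpa using hδ2)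
    have e3 : B * |ur ξ t - ur x t| ≤ ε / 4 := by
      have := mul_le_mul_of_nonneg_left e2.le hB.le
      have h4 : B * (ε / (4 * B)) = ε / 4 := by field_simp
      linarith
    have e4 : (u (x - ζ) (t + h) - u x t) - h * (ut x t - B * ur x t)
        = h * ((ut (x - ζ) τ - ut x t) - B * (ur ξ t - ur x t)) := by
      have : u (x - ζ) (t + h) - u x t = ut (x - ζ) τ * (t + h - t) - ur ξ t * (x - (x - ζ)) := by
        linarith
      rw [this, hζ]; ring
    rw [e4, abs_mul, abs_of_pos hh]
    refine mul_le_mul_of_nonneg_left ?_ hh.le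
    have e5 := abs_sub (ut (x - ζ) τ - ut x t) (B * (ur ξ t - ur x t))
    rw [abs_mul, abs_of_pos hB] at e5
    linarith
  -- the penalized difference
  set κ := ε * h / (t1 + 1) with hκ
  have hκ0 : 0 < κ := by positivity
  have hκ1 : κ * t1 ≤ ε * h := by
    rw [hκ, div_mul_eq_mul_div, div_le_iff₀ (by linarith)]
    nlinarith [mul_pos hε hh]
  have hcont : ContinuousOn (fun p : ℝ × ℝ => u (p.1 - ζ) (p.2 + h) - u p.1 p.2 + κ * p.2)
      (Icc ζ 1 ×ˢ Icc 0 t1) := by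
    have c1 : ContinuousOn (fun p : ℝ × ℝ => u (p.1 - ζ) (p.2 + h)) (Icc ζ 1 ×ˢ Icc 0 t1) := by
      refine hcu.comp (f := fun p : ℝ × ℝ => (p.1 - ζ, p.2 + h)) (by fun_prop) ?_
      rintro ⟨x, t⟩ ⟨hx, ht⟩
      simp only [mem_Icc] at hx ht
      exact ⟨⟨by simp only; linarith, by simp only; linarith⟩,
        hsub ⟨by simp only; linarith, by simp only; linarith⟩⟩
    have c2 : ContinuousOn (fun p : ℝ × ℝ => u p.1 p.2) (Icc ζ 1 ×ˢ Icc 0 t1) :=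
      hcu.mono (prod_mono (Icc_subset_Icc_left hζ0.le)
        ((Icc_subset_Icc_right htT.le).trans hsub))
    exact (c1.sub c2).add (by fun_prop)
  obtain ⟨⟨x, t⟩, ⟨hx, ht⟩, hmin⟩ := (isCompact_Icc.prod isCompact_Icc).exists_isMinOn
    ⟨(x1, t1), ⟨⟨hζx.le, hx1.2⟩, ⟨h0t1, le_rfl⟩⟩⟩ hcont
  simp only at hx ht
  have hmin' : ∀ y ∈ Icc ζ 1, ∀ s ∈ Icc 0 t1,
      u (x - ζ) (t + h) - u x t + κ * t ≤ u (y - ζ) (s + h) - u y s + κ * s :=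
    fun y hy s hs => hmin (show (y, s) ∈ Icc ζ 1 ×ˢ Icc 0 t1 from ⟨hy, hs⟩)
  have hlow : u (x - ζ) (t + h) - u x t + κ * t ≤ h * (A - 5 / 2 * ε) := by
    have g1 := hmin' x1 ⟨hζx.le, hx1.2⟩ t1 ⟨h0t1, le_rfl⟩
    have g2 := (abs_le.1 (happ x1 ⟨hζx.le, hx1.2⟩ t1 ⟨h0t1, le_rfl⟩)).2
    have g3 : h * (ut x1 t1 - B * ur x1 t1) ≤ h * (A - 4 * ε) :=
      mul_le_mul_of_nonneg_left (by linarith) hh.le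
    nlinarith
  have hx0 : 0 < x := by linarith [hx.1]
  have hxI : x ∈ Icc (0:ℝ) 1 := ⟨hx0.le, hx.2⟩
  have hyI : x - ζ ∈ Icc (0:ℝ) 1 := ⟨by linarith [hx.1], by linarith [hx.2]⟩
  have htT1 : t ∈ I := hsub ⟨ht.1, by linarith [ht.2]⟩
  have hthI' : t + h ∈ Icc 0 T1 := ⟨by linarith [ht.1], by linarith [ht.2]⟩
  have hthI : t + h ∈ I := hsub hthI'
  have hf : h * (ut x t - B * ur x t) ≤ h * (A - 2 * ε) := by
    have g2 := (abs_le.1 (happ x hx t ht)).1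
    have := mul_nonneg hκ0.le ht.1
    nlinarith
  have hf' : ut x t - B * ur x t ≤ A - 2 * ε := le_of_mul_le_mul_left hf hh
  have ht0 : 0 < t := by
    rcases ht.1.lt_or_eq with h' | h'
    · exact h'
    · exfalso
      subst h'
      have := hinit x ⟨hx0, hx.2⟩
      linarith
  -- time derivative
  have htime : ut (x - ζ) (t + h) - ut x t + κ ≤ 0 := by
    refine deriv_nonpos_right_end (fun s => u (x - ζ) (s + h) - u x s + κ * s) _ 0 t ht0 ?_
      (fun s hs => hmin' x hx s ⟨hs.1, hs.2.trans ht.2⟩)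
    have d1 : HasDerivWithinAt (fun s => u (x - ζ) (s + h)) (ut (x - ζ) (t + h) * 1) (Icc 0 t) t := by
      refine HasDerivWithinAt.comp (h₂ := fun s => u (x - ζ) s) (h := fun s => s + h) t
        (hut (x - ζ) hyI (t + h) hthI) ((hasDerivWithinAt_id t _).add_const h) ?_
      intro s hs
      exact hsub ⟨by linarith [hs.1], by linarith [hs.2, ht.2]⟩
    have d2 := (hut x hxI t htT1).mono (hI1 t htT1)
    have d3 : HasDerivWithinAt (fun s : ℝ => κ * s) (κ * 1) (Icc 0 t) t :=
      (hasDerivWithinAt_id t _).const_mul κ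
    have d4 := (d1.sub d2).add d3
    rw [mul_one, mul_one] at d4
    exact d4
  -- space derivative
  have hspace : ∀ y ∈ Icc ζ 1, HasDerivWithinAt (fun s => u (s - ζ) (t + h) - u s t)
      (ur (y - ζ) (t + h) - ur y t) (Icc ζ 1) y := by
    intro y hy
    have d1 : HasDerivWithinAt (fun s => u (s - ζ) (t + h)) (ur (y - ζ) (t + h) * 1) (Icc ζ 1) y := by
      refine HasDerivWithinAt.comp (h₂ := fun s => u s (t + h)) (h := fun s => s - ζ) y
        (hur (t + h) hthI (y - ζ) ⟨by linarith [hy.1], by linarith [hy.2]⟩)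
        ((hasDerivWithinAt_id y _).sub_const ζ) ?_
      intro s hs
      exact ⟨by linarith [hs.1], by linarith [hs.2]⟩
    have d2 := (hur t htT1 y ⟨by linarith [hy.1], hy.2⟩).mono (Icc_subset_Icc_left hζ0.le)
    have d4 := d1.sub d2
    rw [mul_one] at d4
    exact d4
  have hsmin : ∀ y ∈ Icc ζ 1, u (x - ζ) (t + h) - u x t ≤ u (y - ζ) (t + h) - u y t := by
    intro y hy
    have := hmin' y hy t ht
    linarith
  rcases hx.1.lt_or_eq with hxl | hxl
  · rcases hx.2.lt_or_eq with hxr | hxr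
    · -- interior
      have hd' : HasDerivAt (fun s => ur (s - ζ) (t + h) - ur s t)
          (urr (x - ζ) (t + h) - urr x t) x := by
        have d1 : HasDerivAt (fun s => ur (s - ζ) (t + h)) (urr (x - ζ) (t + h)) x := by
          have := (hurr (t + h) hthI (x - ζ) hyI).hasDerivAt
            (Icc_mem_nhds (by linarith) (by linarith))
          exact HasDerivAt.comp_sub_const x ζ this
        exact d1.sub ((hurr t htT1 x hxI).hasDerivAt (Icc_mem_nhds hx0 hxr))
      obtain ⟨g1, g2⟩ := second_deriv_test _ (fun s => ur (s - ζ) (t + h) - ur s t) ζ 1 x _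
        ⟨hxl, hxr⟩ (fun s hs => (hspace s ⟨hs.1.le, hs.2.le⟩).hasDerivAt (Icc_mem_nhds hs.1 hs.2))
        hd' (fun s hs => hsmin s ⟨hs.1.le, hs.2.le⟩)
      have := hmono t htT1 (t + h) hthI x ⟨hx0, hx.2⟩ (x - ζ) ⟨by linarith, hyI.2⟩ (by linarith)
        (by linarith) (by linarith)
      linarith
    · -- right boundary
      subst hxr
      have g1 := deriv_nonpos_right_end _ _ ζ 1 hζ1 (hspace 1 hx) hsmin
      have g2 := hηb t ⟨ht.1, by linarith [ht.2]⟩ (by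
        have := (hbd t htT1).2
        rw [this] at hf'
        linarith)
      obtain ⟨ξ, hξ, hξe⟩ := mvt_within (fun s => ur s (t + h)) (fun s => urr s (t + h)) (1 - ζ) 1
        (Icc 0 1) (fun s hs => ⟨by linarith [hs.1], hs.2⟩) (by linarith)
        (fun s hs => hurr (t + h) hthI s ⟨by linarith [hs.1], hs.2⟩)
      have e3 := hU3 ξ ⟨by linarith [hξ.1], hξ.2.le⟩ 1 ⟨zero_le_one, le_rfl⟩ (t + h) hthI' t
        ⟨ht.1, by linarith [ht.2]⟩ (by rw [abs_lt]; constructor <;> linarith [hξ.1, hξ.2])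
        (by rw [abs_lt]; constructor <;> linarith)
      have e4 : urr ξ (t + h) < 0 := by linarith [(abs_lt.1 e3).2]
      rw [(hbd (t + h) hthI).2] at hξe
      rw [(hbd t htT1).2] at g1
      have : urr ξ (t + h) * (1 - (1 - ζ)) < 0 := mul_neg_of_neg_of_pos e4 (by linarith)
      linarith
  · -- left boundary
    subst x
    have g1 := deriv_nonneg_left_end _ _ ζ 1 hζ1 (hspace ζ hx) hsmin
    rw [sub_self, (hbd (t + h) hthI).1] at g1
    have := hpos t htT1 ζ ⟨hζ0, hζ1.le⟩
    linarith

lemma meanCurv_mono_s17 (N : ℕ) (hN : 1 < N) (x y p q q' : ℝ) (hx : 0 < x) (hy : 0 < y) (hyx : y ≤ x)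
    (hp : 0 ≤ p) (hq : q ≤ q') : meanCurv N x p q ≤ meanCurv N y p q' := by
  have hN' : (0:ℝ) ≤ (N:ℝ) - 1 := by
    have : (1:ℝ) < N := by exact_mod_cast hN
    linarith
  unfold meanCurv
  rw [if_neg hx.ne', if_neg hy.ne']
  have : 0 < Real.sqrt (1 + p ^ 2) := Real.sqrt_pos.2 (by positivity)
  gcongr

/-- uniform positive lower bound of `H`, case `b > 0`, `k > 0`, convex
initial data: there is `H_* > 0`, depending only on the data (not on `T₀`), such that
every classical solution on `[0, T₀)` with positive mean curvature satisfies
`H(r,t) ≥ H_*` for `r ∈ (0,1]`, `t ∈ [0, T₀)`. -/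
theorem stmt17 (N : ℕ) (hN : 1 < N) (α b k : ℝ) (hα : 0 < α) (hb : 0 < b) (hk : 0 < k)
    (u₀ u₀' u₀'' : ℝ → ℝ) (hdata : IsC2Data k u₀ u₀' u₀'')
    (hconv : ∀ r ∈ Set.Icc (0 : ℝ) 1, 0 < u₀'' r) :
    ∃ Hlo : ℝ, 0 < Hlo ∧
      ∀ T : ℝ≥0∞, 0 < T → ∀ u ur urr ut : ℝ → ℝ → ℝ,
        IsFlowSol N α b k u₀ u₀' u₀'' (timeSet T) u ur urr ut →
        (∀ t ∈ timeSet T, ∀ r ∈ Set.Icc (0 : ℝ) 1,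
          0 < meanCurv N r (ur r t) (urr r t)) →
        ∀ t ∈ timeSet T, ∀ r ∈ Set.Ioc (0 : ℝ) 1,
          Hlo ≤ meanCurv N r (ur r t) (urr r t) := by
  have hN' : (0:ℝ) < (N:ℝ) - 1 := by
    have : (1:ℝ) < N := by exact_mod_cast hN
    linarith
  obtain ⟨-, hd2, hc2, h00, h01⟩ := hdata
  obtain ⟨r0, hr0, hr0m⟩ := isCompact_Icc.exists_isMinOn ⟨(0:ℝ), ⟨le_rfl, zero_le_one⟩⟩ hc2
  set m := u₀'' r0 with hm
  have hm0 : 0 < m := hconv r0 hr0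
  have hmle : ∀ r ∈ Icc (0:ℝ) 1, m ≤ u₀'' r := fun r hr => hr0m hr
  set μ := min m k with hμ
  have hμ0 : 0 < μ := lt_min hm0 hk
  set q := Real.sqrt (1 + k ^ 2) with hq
  have hq0 : 0 < q := Real.sqrt_pos.2 (by positivity)
  set Hlo := ((N:ℝ) - 1) * μ / q with hHlo
  have hH0 : 0 < Hlo := by positivity
  refine ⟨Hlo, hH0, ?_⟩
  -- bounds on the initial slope
  have hs1 : ∀ r ∈ Ioc (0:ℝ) 1, m * r ≤ u₀' r := by
    intro r hr
    obtain ⟨ξ, hξ, hξe⟩ := mvt_within u₀' u₀'' 0 r (Icc 0 1)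
      (Icc_subset_Icc_right hr.2) hr.1 (fun s hs => hd2 s ⟨hs.1, hs.2.trans hr.2⟩)
    have := hmle ξ ⟨hξ.1.le, hξ.2.le.trans hr.2⟩
    rw [h00, sub_zero, sub_zero] at hξe
    rw [hξe]
    exact mul_le_mul_of_nonneg_right this hr.1.le
  have hs2 : ∀ r ∈ Ioc (0:ℝ) 1, u₀' r ≤ k := by
    intro r hr
    rcases hr.2.lt_or_eq with h | h
    · obtain ⟨ξ, hξ, hξe⟩ := mvt_within u₀' u₀'' r 1 (Icc 0 1)
        (Icc_subset_Icc_left hr.1.le) h (fun s hs => hd2 s ⟨hr.1.le.trans hs.1, hs.2⟩)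
      have := hconv ξ ⟨hr.1.le.trans hξ.1.le, hξ.2.le⟩
      have h2 := mul_pos this (sub_pos.2 h)
      rw [h01] at hξe
      linarith
    · rw [h, h01]
  have hHinit : ∀ r ∈ Ioc (0:ℝ) 1, Hlo ≤ meanCurv N r (u₀' r) (u₀'' r) := by
    intro r hr
    have hr0 := hr.1
    unfold meanCurv
    rw [if_neg hr.1.ne']
    have g1 := hs1 r hr
    have g2 := hs2 r hr
    have g0 : 0 < u₀' r := lt_of_lt_of_le (by positivity) g1
    have g3 : 0 ≤ u₀'' r / (1 + u₀' r ^ 2) ^ ((3 : ℝ) / 2) :=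
      div_nonneg (hconv r ⟨hr.1.le, hr.2⟩).le (by positivity)
    have g4 : Real.sqrt (1 + u₀' r ^ 2) ≤ q := Real.sqrt_le_sqrt (by gcongr)
    have g5 : 0 < Real.sqrt (1 + u₀' r ^ 2) := Real.sqrt_pos.2 (by positivity)
    have g6 : Hlo ≤ ((N : ℝ) - 1) * u₀' r / (r * Real.sqrt (1 + u₀' r ^ 2)) := by
      rw [hHlo, div_le_div_iff₀ hq0 (by positivity)]
      have : μ * r ≤ u₀' r := le_trans (mul_le_mul_of_nonneg_right (min_le_left _ _) hr.1.le) g1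
      calc ((N:ℝ) - 1) * μ * (r * Real.sqrt (1 + u₀' r ^ 2))
          = ((N:ℝ) - 1) * (μ * r) * Real.sqrt (1 + u₀' r ^ 2) := by ring
        _ ≤ ((N:ℝ) - 1) * u₀' r * q := by gcongr
    linarith
  intro T hT u ur urr ut hsol hH
  obtain ⟨hcu, hcur, hcurr, hcut, hur, hurr, hut, hini, hbd, heq⟩ := hsol
  have hI0 : ∀ t ∈ timeSet T, 0 ≤ t := fun t ht => ht.1
  have hI1 : ∀ t ∈ timeSet T, Icc 0 t ⊆ timeSet T := fun t ht s hs =>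
    ⟨hs.1, lt_of_le_of_lt (ENNReal.ofReal_le_ofReal hs.2) ht.2⟩
  have hI2 : ∀ t ∈ timeSet T, ∃ t' ∈ timeSet T, t < t' := by
    intro t ht
    obtain ⟨c, hc1, hc2⟩ := ENNReal.lt_iff_exists_nnreal_btwn.1 ht.2
    refine ⟨c, ⟨c.2, by simpa using hc2⟩, ?_⟩
    by_contra hcon
    push Not at hcon
    have := ENNReal.ofReal_le_ofReal hcon
    rw [ENNReal.ofReal_coe_nnreal] at this
    exact absurd hc1 (not_lt.2 this)
  have h0I : (0:ℝ) ∈ timeSet T := ⟨le_rfl, by simpa using hT⟩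
  have hoI : ∀ r ∈ Ioc (0:ℝ) 1, r ∈ Icc (0:ℝ) 1 := fun r hr => ⟨hr.1.le, hr.2⟩
  have h1I : (1:ℝ) ∈ Ioc (0:ℝ) 1 := ⟨one_pos, le_rfl⟩
  -- the slope is positive
  have hpos : ∀ t ∈ timeSet T, ∀ r ∈ Ioc (0:ℝ) 1, 0 < ur r t := by
    intro t ht r hr
    by_contra hcon
    push Not at hcon
    have hc : ContinuousOn (fun s => ur s t) (Icc 0 1) :=
      fun s hs => (hurr t ht s hs).continuousWithinAt
    obtain ⟨r1, hr1, hr1m⟩ := isCompact_Icc.exists_isMinOn ⟨(0:ℝ), ⟨le_rfl, zero_le_one⟩⟩ hc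
    obtain ⟨r2, hr2, hr2le, hr2m⟩ : ∃ r2 ∈ Ioc (0:ℝ) 1, ur r2 t ≤ 0 ∧
        ∀ s ∈ Icc (0:ℝ) 1, ur r2 t ≤ ur s t := by
      rcases hr1.1.lt_or_eq with h | h
      · exact ⟨r1, ⟨h, hr1.2⟩, (hr1m (hoI r hr)).trans hcon, fun s hs => hr1m hs⟩
      · subst h
        refine ⟨r, hr, hcon, fun s hs => ?_⟩
        have : ur 0 t ≤ ur s t := hr1m hs
        rw [(hbd t ht).1] at this
        linarith
    have hr2lt : r2 < 1 := by
      rcases hr2.2.lt_or_eq with h | h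
      · exact h
      · rw [h, (hbd t ht).2] at hr2le
        linarith
    have hd := (hurr t ht r2 (hoI r2 hr2)).hasDerivAt (Icc_mem_nhds hr2.1 hr2lt)
    have hloc : IsLocalMin (fun s => ur s t) r2 := by
      filter_upwards [Icc_mem_nhds hr2.1 hr2lt] with s hs using hr2m s hs
    have hz := hloc.hasDerivAt_eq_zero hd
    have hHp := hH t ht r2 (hoI r2 hr2)
    unfold meanCurv at hHp
    rw [if_neg hr2.1.ne', hz, zero_div, zero_add] at hHp
    have hr2p := hr2.1
    have : ((N : ℝ) - 1) * ur r2 t / (r2 * Real.sqrt (1 + ur r2 t ^ 2)) ≤ 0 :=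
      div_nonpos_of_nonpos_of_nonneg (mul_nonpos_of_nonneg_of_nonpos hN'.le hr2le) (by positivity)
    linarith
  have heq' : ∀ t ∈ timeSet T, ∀ r ∈ Ioc (0:ℝ) 1,
      ut r t = (meanCurv N r (ur r t) (urr r t) ^ α + b) * Real.sqrt (1 + ur r t ^ 2) := by
    intro t ht r hr
    rw [heq t ht r hr, oddPow, if_pos (hH t ht r (hoI r hr)).le]
  set c := Hlo ^ α + b with hc
  have hc0 : 0 < c := by positivity
  intro t ht r hr
  set p := ur r t with hp
  have hp0 : 0 < p := hpos t ht r hr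
  set s := Real.sqrt (1 + p ^ 2) with hs
  have hs0 : 0 < s := Real.sqrt_pos.2 (by positivity)
  have hss : s ^ 2 = 1 + p ^ 2 := Real.sq_sqrt (by positivity)
  -- the chosen supporting line lies below `c √(1+z²)`
  have hsupp : ∀ z : ℝ, c / s + c * p / s * z ≤ c * Real.sqrt (1 + z ^ 2) := by
    intro z
    have e : c / s + c * p / s * z = c * ((1 + p * z) / s) := by field_simp
    rw [e]
    refine mul_le_mul_of_nonneg_left ?_ hc0.le
    rw [div_le_iff₀ hs0, hs, ← Real.sqrt_mul (by positivity)]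
    apply Real.le_sqrt_of_sq_le
    nlinarith [sq_nonneg (p - z)]
  have hfin := key (c / s) (c * p / s) k (by positivity) (timeSet T) hI0 hI1 hI2 u ur urr ut
    hcu hcur hcurr hcut hur hurr hut hbd hpos ?_ ?_ ?_ t ht r hr
  · have e : c / s + c * p / s * p = c * s := by
      field_simp
      rw [hss]
    rw [← hp, e, heq' t ht r hr, ← hp, ← hs] at hfin
    have h1 := le_of_mul_le_mul_right hfin hs0
    have h2 : Hlo ^ α ≤ meanCurv N r p (urr r t) ^ α := by linarith
    exact (Real.rpow_le_rpow_iff hH0.le (hH t ht r (hoI r hr)).le hα).1 h2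
  · intro t ht t' ht' x hx y hy hyx he hle
    rw [heq' t ht x hx, heq' t' ht' y hy, he]
    have h1 := meanCurv_mono_s17 N hN x y (ur x t) _ _ hx.1 hy.1 hyx (hpos t ht x hx).le hle
    have h2 := (hH t ht x (hoI x hx)).le
    gcongr
  · intro t ht hlt
    have h1 := hlt.trans_le (hsupp k)
    rw [heq' t ht 1 h1I, (hbd t ht).2, ← hq] at h1
    have h2 := lt_of_mul_lt_mul_right h1 hq0.le
    have hHp := (hH t ht 1 (hoI 1 h1I)).le
    rw [(hbd t ht).2] at hHp
    have h3 : meanCurv N 1 k (urr 1 t) < Hlo :=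
      (Real.rpow_lt_rpow_iff hHp hH0.le hα).1 (by linarith)
    unfold meanCurv at h3
    rw [if_neg one_ne_zero, one_mul, ← hq] at h3
    have h4 : Hlo ≤ ((N:ℝ) - 1) * k / q := by
      rw [hHlo]
      have : μ ≤ k := min_le_right _ _
      gcongr
    have h5 : urr 1 t / (1 + k ^ 2) ^ ((3:ℝ) / 2) < 0 := by linarith
    by_contra hcon
    push Not at hcon
    exact absurd (div_nonneg hcon (by positivity)) (not_le.2 h5)
  · intro x hx
    refine (hsupp _).trans ?_
    rw [heq' 0 h0I x hx]
    have h1 := hHinit x hx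
    rw [← (hini x (hoI x hx)).2.1, ← (hini x (hoI x hx)).2.2] at h1
    rw [hc]
    gcongr
end
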